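/- arXiv:1406.1323 — 4 statements merged into one kernel-verified Lean document; each statement's English description precedes it below -/
import Mathlib

section
/- Let (R, m) be a complete Noetherian local ring, M a finitely generated R-module, and a an ideal of R. Then for any non-negative integer n, f_a^n(M) = f_a^a(M)_n. -/
open CategoryTheory

universe u

/-- Carrier of the `i`-th local cohomology module `H^i_a(M)` with support in `V(a)`. -/
noncomputable def locH (R : Type u) [CommRing R] (a : Ideal R) (i : ℕ)
    (M : Type u) [AddCommGroup M] [Module R M] : ModuleCat R :=
  (localCohomology a i).obj (ModuleCat.of R M)

/-- Krull dimension of the support of a module. -/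
noncomputable def dimSupp (R : Type u) [CommRing R]
    (M : Type u) [AddCommGroup M] [Module R M] : WithBot ℕ∞ :=
  Order.krullDim (Module.support R M)

/-- `f_a^b(M) = inf{i : b^n H^i_a(M) ≠ 0 for all n}`, the `b`-finiteness dimension
of `M` relative to `a` (`inf ∅ = ⊤`). -/
noncomputable def fab (R : Type u) [CommRing R] (a b : Ideal R)
    (M : Type u) [AddCommGroup M] [Module R M] : ℕ∞ :=
  sInf ((↑) '' {i : ℕ |
    ∀ n : ℕ, b ^ n • (⊤ : Submodule R (locH R a i M)) ≠ ⊥})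

/-- `f_a^b(M)_n = inf{i : dim Supp (b^t H^i_a(M)) ≥ n for all t}`. -/
noncomputable def fabn (R : Type u) [CommRing R] (a b : Ideal R)
    (M : Type u) [AddCommGroup M] [Module R M] (n : ℕ) : ℕ∞ :=
  sInf ((↑) '' {i : ℕ |
    ∀ t : ℕ, (n : WithBot ℕ∞) ≤ dimSupp R ↥(b ^ t • (⊤ : Submodule R (locH R a i M)))})

/-- `f_a^b(M)^n = inf{f_{aR_p}^{bR_p}(M_p) : p ∈ Spec R, dim R/p ≥ n}`. -/
noncomputable def fabUpper (R : Type u) [CommRing R] (a b : Ideal R)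
    (M : Type u) [AddCommGroup M] [Module R M] (n : ℕ) : ℕ∞ :=
  sInf {d : ℕ∞ | ∃ p : PrimeSpectrum R, (n : WithBot ℕ∞) ≤ ringKrullDim (R ⧸ p.asIdeal) ∧
    d = fab (Localization.AtPrime p.asIdeal)
      (a.map (algebraMap R (Localization.AtPrime p.asIdeal)))
      (b.map (algebraMap R (Localization.AtPrime p.asIdeal)))
      (LocalizedModule p.asIdeal.primeCompl M)}

/-- `f_a(M) = inf{i : H^i_a(M) is not finitely generated}`, the finiteness dimension. -/
noncomputable def finDim (R : Type u) [CommRing R] (a : Ideal R)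
    (M : Type u) [AddCommGroup M] [Module R M] : ℕ∞ :=
  sInf ((↑) '' {i : ℕ | ¬ Module.Finite R (locH R a i M)})

/-- The `i`-th Ext module `Ext^i_R(N, N')`. -/
noncomputable def extMod (R : Type u) [CommRing R] (i : ℕ)
    (N : Type u) [AddCommGroup N] [Module R N]
    (N' : Type u) [AddCommGroup N'] [Module R N'] : ModuleCat R :=
  ((Ext R (ModuleCat.{u} R) i).obj (Opposite.op (ModuleCat.of R N))).obj (ModuleCat.of R N')

/-- `N` is `b`-cofinite: `Supp N ⊆ V(b)` and `Ext^i_R(R/b, N)` is finitely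
generated for all `i ≥ 0`. -/
def IsCofinite (R : Type u) [CommRing R] (b : Ideal R)
    (N : Type u) [AddCommGroup N] [Module R N] : Prop :=
  Module.support R N ⊆ PrimeSpectrum.zeroLocus (b : Set R) ∧
    ∀ i : ℕ, Module.Finite R (extMod R i (R ⧸ b) N)

/-- `c_a^b(M) = inf{i : H^i_a(M) is not b-cofinite}`, the `b`-cofiniteness dimension. -/
noncomputable def cofDim (R : Type u) [CommRing R] (a b : Ideal R)
    (M : Type u) [AddCommGroup M] [Module R M] : ℕ∞ :=
  sInf ((↑) '' {i : ℕ | ¬ IsCofinite R b (locH R a i M)})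

/-- `depth(b, M)`: the supremum of lengths of `M`-regular sequences contained in `b`
(the common length of maximal `M`-regular sequences in `b`). -/
noncomputable def mdepth (R : Type u) [CommRing R] (b : Ideal R)
    (M : Type u) [AddCommGroup M] [Module R M] : ℕ∞ :=
  sSup {d : ℕ∞ | ∃ rs : List R, d = rs.length ∧ (∀ r ∈ rs, r ∈ b) ∧
    RingTheory.Sequence.IsRegular M rs}

/-- `f_a^n(M) = inf{f_{aR_p}(M_p) : p ∈ Supp(M/aM), dim R/p ≥ n}`. -/
noncomputable def fan (R : Type u) [CommRing R] (a : Ideal R)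
    (M : Type u) [AddCommGroup M] [Module R M] (n : ℕ) : ℕ∞ :=
  sInf {d : ℕ∞ | ∃ p : PrimeSpectrum R,
    p ∈ Module.support R (M ⧸ (a • ⊤ : Submodule R M)) ∧
    (n : WithBot ℕ∞) ≤ ringKrullDim (R ⧸ p.asIdeal) ∧
    d = finDim (Localization.AtPrime p.asIdeal)
      (a.map (algebraMap R (Localization.AtPrime p.asIdeal)))
      (LocalizedModule p.asIdeal.primeCompl M)}

/-- `M` is in dimension `< n`: there is a finitely generated submodule `N ⊆ M`
with `dim Supp (M/N) < n`. -/
def InDimLT (R : Type u) [CommRing R] (n : ℕ)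
    (M : Type u) [AddCommGroup M] [Module R M] : Prop :=
  ∃ N : Submodule R M, N.FG ∧ dimSupp R (M ⧸ N) < (n : WithBot ℕ∞)

section LCauxAll
open Limits

namespace LCaux

section LES
universe v₁ v₂ u₁ u₂
variable {C : Type u₁} [Category.{v₁} C] {D : Type u₂} [Category.{v₂} D] [Abelian C] [Abelian D]
  [HasProjectiveResolutions C]
  {F G H : C ⥤ D} [F.Additive] [G.Additive] [H.Additive] (α : F ⟶ G) (β : G ⟶ H)
  (w : ∀ X, α.app X ≫ β.app X = 0)

/-- The short complex of complexes. -/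
noncomputable def cseq (K : ChainComplex C ℕ) : ShortComplex (ChainComplex D ℕ) :=
  ShortComplex.mk ((NatTrans.mapHomologicalComplex α _).app K)
    ((NatTrans.mapHomologicalComplex β _).app K) (by
      ext i
      exact w (K.X i))

noncomputable def cseqMap {K L : ChainComplex C ℕ} (φ : K ⟶ L) : cseq α β w K ⟶ cseq α β w L where
  τ₁ := (F.mapHomologicalComplex _).map φ
  τ₂ := (G.mapHomologicalComplex _).map φ
  τ₃ := (H.mapHomologicalComplex _).map φ
  comm₁₂ := by ext i; exact α.naturality (φ.f i)
  comm₂₃ := by ext i; exact β.naturality (φ.f i)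

variable (hS : ∀ P : C, Projective P → (ShortComplex.mk (α.app P) (β.app P) (w P)).ShortExact)

lemma cseq_shortExact (hS : ∀ P : C, Projective P →
    (ShortComplex.mk (α.app P) (β.app P) (w P)).ShortExact) (K : ChainComplex C ℕ) (hK : ∀ i, Projective (K.X i)) :
    (cseq α β w K).ShortExact :=
  HomologicalComplex.shortExact_of_degreewise_shortExact _ (fun i => hS _ (hK i))

/-- homology of the image of a complex under a functor -/
noncomputable def LH (F : C ⥤ D) [F.Additive] (n : ℕ) : ChainComplex C ℕ ⥤ D :=
  F.mapHomologicalComplex _ ⋙ HomologicalComplex.homologyFunctor D (ComplexShape.down ℕ) n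

/-- functoriality of `LH` in the functor -/
noncomputable def LHm {F G : C ⥤ D} [F.Additive] [G.Additive] (α : F ⟶ G) (n : ℕ)
    (K : ChainComplex C ℕ) : (LH F n).obj K ⟶ (LH G n).obj K :=
  (HomologicalComplex.homologyFunctor D (ComplexShape.down ℕ) n).map
    ((NatTrans.mapHomologicalComplex α _).app K)

/-- connecting map on complexes -/
noncomputable def cdel (n : ℕ) (K : ChainComplex C ℕ) (hK : ∀ i, Projective (K.X i)) :
    (LH H (n+1)).obj K ⟶ (LH F n).obj K :=
  (cseq_shortExact α β w hS K hK).δ (n+1) n (by simp)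

lemma cdel_nat (n : ℕ) {K L : ChainComplex C ℕ} (hK : ∀ i, Projective (K.X i))
    (hL : ∀ i, Projective (L.X i)) (φ : K ⟶ L) :
    (LH H (n+1)).map φ ≫ cdel α β w hS n L hL = cdel α β w hS n K hK ≫ (LH F n).map φ :=
  (HomologicalComplex.HomologySequence.δ_naturality (cseqMap α β w φ)
    (cseq_shortExact α β w hS K hK) (cseq_shortExact α β w hS L hL) (n+1) n (by simp)).symm

lemma cex_one (n : ℕ) (K : ChainComplex C ℕ) (hK : ∀ i, Projective (K.X i)) :
    ∃ h, (ShortComplex.mk (cdel α β w hS n K hK) (LHm α n K) h).Exact :=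
  ⟨_, (cseq_shortExact α β w hS K hK).homology_exact₁ (n+1) n (by simp)⟩

lemma cex_two (hS : ∀ P : C, Projective P →
    (ShortComplex.mk (α.app P) (β.app P) (w P)).ShortExact) (n : ℕ) (K : ChainComplex C ℕ) (hK : ∀ i, Projective (K.X i)) :
    ∃ h, (ShortComplex.mk (LHm α n K) (LHm β n K) h).Exact :=
  ⟨_, (cseq_shortExact α β w hS K hK).homology_exact₂ n⟩

lemma cex_three (n : ℕ) (K : ChainComplex C ℕ) (hK : ∀ i, Projective (K.X i)) :
    ∃ h, (ShortComplex.mk (LHm β (n+1) K) (cdel α β w hS n K hK) h).Exact :=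
  ⟨_, (cseq_shortExact α β w hS K hK).homology_exact₃ (n+1) n (by simp)⟩

/-- clean version of `isoLeftDerivedObj` -/
noncomputable def lIso (F : C ⥤ D) [F.Additive] (n : ℕ) (X : C) :
    (F.leftDerived n).obj X ≅ (LH F n).obj (projectiveResolution X).complex :=
  (projectiveResolution X).isoLeftDerivedObj F n

lemma lIso_nat (F : C ⥤ D) [F.Additive] (n : ℕ) {X Y : C} (f : X ⟶ Y) :
    (F.leftDerived n).map f ≫ (lIso F n Y).hom =
      (lIso F n X).hom ≫ (LH F n).map (ProjectiveResolution.lift f _ _) :=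
  ProjectiveResolution.isoLeftDerivedObj_hom_naturality f (projectiveResolution X)
    (projectiveResolution Y) (ProjectiveResolution.lift f _ _)
    (ProjectiveResolution.lift_commutes_zero f _ _) F n

lemma lIso_nat' {F G : C ⥤ D} [F.Additive] [G.Additive] (α : F ⟶ G) (n : ℕ) (X : C) :
    (NatTrans.leftDerived α n).app X =
      (lIso F n X).hom ≫ LHm α n _ ≫ (lIso G n X).inv :=
  ProjectiveResolution.leftDerived_app_eq α (projectiveResolution X) n

/-- the connecting map of left derived functors -/
noncomputable def del (n : ℕ) (X : C) : (H.leftDerived (n+1)).obj X ⟶ (F.leftDerived n).obj X :=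
  (lIso H (n+1) X).hom ≫ cdel α β w hS n _ (fun _ => inferInstance) ≫ (lIso F n X).inv

lemma del_naturality (n : ℕ) {X Y : C} (f : X ⟶ Y) :
    (H.leftDerived (n+1)).map f ≫ del α β w hS n Y =
      del α β w hS n X ≫ (F.leftDerived n).map f := by
  rw [← cancel_mono (lIso F n Y).hom]
  unfold del
  simp only [Category.assoc, Iso.inv_hom_id, Category.comp_id, lIso_nat]
  rw [reassoc_of% (lIso_nat H (n+1) f), cdel_nat α β w hS n (fun _ => inferInstance)
    (fun _ => inferInstance), Iso.inv_hom_id_assoc]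

lemma exact_transfer {A B E A' B' E' : D} {f : A ⟶ B} {g : B ⟶ E} {f' : A' ⟶ B'} {g' : B' ⟶ E'}
    (a : A ≅ A') (b : B ≅ B') (e : E ≅ E') (hf : f = a.hom ≫ f' ≫ b.inv)
    (hg : g = b.hom ≫ g' ≫ e.inv) (h : ∃ h, (ShortComplex.mk f' g' h).Exact) :
    ∃ h, (ShortComplex.mk f g h).Exact := by
  obtain ⟨h0, h⟩ := h
  have hz : f ≫ g = 0 := by
    rw [hf, hg]
    simp [reassoc_of% h0]
  refine ⟨hz, ShortComplex.exact_of_iso (ShortComplex.isoMk a.symm b.symm e.symm ?_ ?_) h⟩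
  · simp [hf]
  · simp [hg]

lemma ex_one (n : ℕ) (X : C) : ∃ h, (ShortComplex.mk (del α β w hS n X)
    ((NatTrans.leftDerived α n).app X) h).Exact :=
  exact_transfer (lIso H (n+1) X) (lIso F n X) (lIso G n X) rfl (lIso_nat' α n X)
    (cex_one α β w hS n _ (fun _ => inferInstance))

lemma ex_two (hS : ∀ P : C, Projective P →
    (ShortComplex.mk (α.app P) (β.app P) (w P)).ShortExact) (n : ℕ) (X : C) : ∃ h, (ShortComplex.mk ((NatTrans.leftDerived α n).app X)
    ((NatTrans.leftDerived β n).app X) h).Exact :=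
  exact_transfer (lIso F n X) (lIso G n X) (lIso H n X) (lIso_nat' α n X) (lIso_nat' β n X)
    (cex_two α β w hS n _ (fun _ => inferInstance))

lemma ex_three (n : ℕ) (X : C) : ∃ h, (ShortComplex.mk ((NatTrans.leftDerived β (n+1)).app X)
    (del α β w hS n X) h).Exact :=
  exact_transfer (lIso G (n+1) X) (lIso H (n+1) X) (lIso F n X) (lIso_nat' β (n+1) X) rfl
    (cex_three α β w hS n _ (fun _ => inferInstance))

/-- comparison with the opcycles -/
noncomputable def opi (F : C ⥤ D) [F.Additive] (K : ChainComplex C ℕ) :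
    (LH F 0).obj K ⟶ ((F.mapHomologicalComplex _).obj K).opcycles 0 :=
  (ChainComplex.isoHomologyι₀ _).hom

lemma opi_nat {F G : C ⥤ D} [F.Additive] [G.Additive] (α : F ⟶ G) (K : ChainComplex C ℕ) :
    LHm α 0 K ≫ opi G K = opi F K ≫ HomologicalComplex.opcyclesMap
      ((NatTrans.mapHomologicalComplex α (ComplexShape.down ℕ)).app K) 0 :=
  HomologicalComplex.homologyι_naturality _ _

lemma fromLDZ_eq (F : C ⥤ D) [F.Additive] (X : C) :
    F.fromLeftDerivedZero.app X = (lIso F 0 X).hom ≫ opi F _ ≫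
      (projectiveResolution X).fromLeftDerivedZero' F :=
  (projectiveResolution X).fromLeftDerivedZero_eq F

/-- naturality of `fromLeftDerivedZero` in the functor. -/
lemma zero_nat {F G : C ⥤ D} [F.Additive] [G.Additive] (α : F ⟶ G) (X : C) :
    (NatTrans.leftDerived α 0).app X ≫ G.fromLeftDerivedZero.app X =
    F.fromLeftDerivedZero.app X ≫ α.app X := by
  rw [lIso_nat', fromLDZ_eq, fromLDZ_eq]
  have : HomologicalComplex.opcyclesMap
      ((NatTrans.mapHomologicalComplex α (ComplexShape.down ℕ)).app
        (projectiveResolution X).complex) 0 ≫ (projectiveResolution X).fromLeftDerivedZero' G =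
      (projectiveResolution X).fromLeftDerivedZero' F ≫ α.app X := by
    simp only [← cancel_epi (HomologicalComplex.pOpcycles _ _),
      HomologicalComplex.p_opcyclesMap_assoc,
      ProjectiveResolution.pOpcycles_comp_fromLeftDerivedZero',
      ProjectiveResolution.pOpcycles_comp_fromLeftDerivedZero'_assoc]
    exact (α.naturality _).symm
  simp only [Category.assoc, Iso.inv_hom_id_assoc, ← this]
  rw [reassoc_of% (opi_nat α (projectiveResolution X).complex)]

end LES
end LCaux

namespace LCaux
section ExtMod
variable {R : Type u} [CommRing R]

/-- The functor whose left derived functors give Ext. -/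
noncomputable abbrev Ft (Y : ModuleCat.{u} R) : ModuleCat.{u} R ⥤ (ModuleCat.{u} R)ᵒᵖ :=
  ((linearYoneda R (ModuleCat.{u} R)).obj Y).rightOp

noncomputable abbrev Ftm {A B : ModuleCat.{u} R} (f : A ⟶ B) : Ft B ⟶ Ft A :=
  NatTrans.rightOp ((linearYoneda R (ModuleCat.{u} R)).map f)

lemma Ft_w (S : ShortComplex (ModuleCat.{u} R)) (X : ModuleCat.{u} R) :
    (Ftm S.g).app X ≫ (Ftm S.f).app X = 0 := by
  rw [← NatTrans.comp_app]
  apply Quiver.Hom.unop_inj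
  ext x
  exact (Category.assoc x S.f S.g).trans (by rw [S.zero]; exact comp_zero)

lemma Ft_shortExact (S : ShortComplex (ModuleCat.{u} R)) (hS : S.ShortExact)
    (P : ModuleCat.{u} R) (hP : Projective P) :
    (ShortComplex.mk ((Ftm S.g).app P) ((Ftm S.f).app P) (Ft_w S P)).ShortExact := by
  have := hS.mono_f
  have := hS.epi_g
  have key : (ShortComplex.mk (((linearYoneda R (ModuleCat.{u} R)).map S.f).app (Opposite.op P))
     (((linearYoneda R (ModuleCat.{u} R)).map S.g).app (Opposite.op P))
     (congrArg Quiver.Hom.unop (Ft_w S P))).ShortExact := by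
    refine ShortComplex.ShortExact.mk' ?_ ?_ ?_
    · rw [ShortComplex.moduleCat_exact_iff]
      intro (x : P ⟶ S.X₂) (hx : x ≫ S.g = 0)
      exact ⟨hS.exact.lift x hx, hS.exact.lift_f x hx⟩
    · rw [ModuleCat.mono_iff_injective]
      intro (x : P ⟶ S.X₁) (y : P ⟶ S.X₁) (h : x ≫ S.f = y ≫ S.f)
      exact (cancel_mono S.f).1 h
    · rw [ModuleCat.epi_iff_surjective]
      intro (x : P ⟶ S.X₃)
      exact ⟨Projective.factorThru x S.g, Projective.factorThru_comp x S.g⟩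
  exact key.op

/-- The Ext module. -/
noncomputable abbrev EX (i : ℕ) (X Y : ModuleCat.{u} R) : ModuleCat.{u} R :=
  ((Ext R (ModuleCat.{u} R) i).obj (Opposite.op X)).obj Y

noncomputable abbrev EXm (i : ℕ) (X : ModuleCat.{u} R) {A B : ModuleCat.{u} R} (f : A ⟶ B) :
    EX i X A ⟶ EX i X B := ((Ext R (ModuleCat.{u} R) i).obj (Opposite.op X)).map f

noncomputable abbrev EXr (i : ℕ) {X X' : ModuleCat.{u} R} (g : X' ⟶ X) (A : ModuleCat.{u} R) :
    EX i X A ⟶ EX i X' A := ((Ext R (ModuleCat.{u} R) i).map g.op).app A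

noncomputable def EXd {S : ShortComplex (ModuleCat.{u} R)} (hS : S.ShortExact) (i : ℕ)
    (X : ModuleCat.{u} R) : EX i X S.X₃ ⟶ EX (i+1) X S.X₁ :=
  (del (Ftm S.g) (Ftm S.f) (Ft_w S) (Ft_shortExact S hS) i X).unop

lemma EXd_nat {S : ShortComplex (ModuleCat.{u} R)} (hS : S.ShortExact) (i : ℕ)
    {X X' : ModuleCat.{u} R} (g : X' ⟶ X) :
    EXd hS i X ≫ EXr (i+1) g S.X₁ = EXr i g S.X₃ ≫ EXd hS i X' :=
  congrArg Quiver.Hom.unop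
    (del_naturality (Ftm S.g) (Ftm S.f) (Ft_w S) (Ft_shortExact S hS) i g)

lemma unop_exact {A B E : (ModuleCat.{u} R)ᵒᵖ} {f : A ⟶ B} {g : B ⟶ E}
    (h : ∃ h, (ShortComplex.mk f g h).Exact) : Function.Exact g.unop f.unop := by
  obtain ⟨h0, h⟩ := h
  exact (ShortComplex.ShortExact.moduleCat_exact_iff_function_exact _).1 h.unop

lemma EX_exact₂ {S : ShortComplex (ModuleCat.{u} R)} (hS : S.ShortExact) (i : ℕ)
    (X : ModuleCat.{u} R) : Function.Exact (EXm i X S.f) (EXm i X S.g) :=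
  unop_exact (ex_two (Ftm S.g) (Ftm S.f) (Ft_w S) (Ft_shortExact S hS) i X)

lemma EX_exact₃ {S : ShortComplex (ModuleCat.{u} R)} (hS : S.ShortExact) (i : ℕ)
    (X : ModuleCat.{u} R) : Function.Exact (EXm i X S.g) (EXd hS i X) :=
  unop_exact (ex_one (Ftm S.g) (Ftm S.f) (Ft_w S) (Ft_shortExact S hS) i X)

lemma EX_exact₁ {S : ShortComplex (ModuleCat.{u} R)} (hS : S.ShortExact) (i : ℕ)
    (X : ModuleCat.{u} R) : Function.Exact (EXd hS i X) (EXm (i+1) X S.f) :=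
  unop_exact (ex_three (Ftm S.g) (Ftm S.f) (Ft_w S) (Ft_shortExact S hS) i X)

lemma EX_inj (i : ℕ) (X E : ModuleCat.{u} R) [Injective E] (x : EX (i+1) X E) : x = 0 := by
  have : IsZero (EX (i+1) X E) := by
    refine IsZero.of_iso ?_ ((projectiveResolution X).isoExt (i+1) E)
    rw [← HomologicalComplex.exactAt_iff_isZero_homology,
      HomologicalComplex.exactAt_iff' _ i (i+1) (i+2) (by simp) (by simp)]
    rw [ShortComplex.moduleCat_exact_iff]
    intro (z : (projectiveResolution X).complex.X (i+1) ⟶ E)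
      (hz : (projectiveResolution X).complex.d (i+2) (i+1) ≫ z = 0)
    have h := (projectiveResolution X).complex_exactAt_succ i
    rw [HomologicalComplex.exactAt_iff' _ (i+2) (i+1) i (by simp) (by simp)] at h
    exact ⟨h.descToInjective z hz, h.comp_descToInjective z hz⟩
  have h2 := (ModuleCat.isZero_iff_subsingleton).1 this
  exact Subsingleton.elim _ _

lemma LHm_smul (i : ℕ) (A : ModuleCat.{u} R) (r : R) (K : ChainComplex (ModuleCat.{u} R) ℕ)
    (x : ((LH (Ft A) i).obj K).unop) :
    (LHm (Ftm (r • 𝟙 A)) i K).unop x = r • x := by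
  let K' := ((Ft A).mapHomologicalComplex (ComplexShape.down ℕ)).obj K
  let ρ : K' ⟶ K' := (NatTrans.mapHomologicalComplex (Ftm (r • 𝟙 A)) (ComplexShape.down ℕ)).app K
  have h1 : HomologicalComplex.homologyMap ρ i ≫ K'.homologyι i =
    K'.homologyι i ≫ HomologicalComplex.opcyclesMap ρ i :=
    HomologicalComplex.homologyι_naturality _ _
  have h2 : K'.pOpcycles i ≫ HomologicalComplex.opcyclesMap ρ i = ρ.f i ≫ K'.pOpcycles i :=
    HomologicalComplex.p_opcyclesMap _ _
  have s1 : Function.Surjective (K'.homologyι i).unop :=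
    (ModuleCat.epi_iff_surjective _).1 inferInstance
  have s2 : Function.Injective (K'.pOpcycles i).unop :=
    (ModuleCat.mono_iff_injective _).1 inferInstance
  obtain ⟨y, rfl⟩ := s1 x
  have h3 : (HomologicalComplex.opcyclesMap ρ i).unop y = r • y := by
    apply s2
    have := congrArg (fun t => t.unop y) h2
    refine Eq.trans this ?_
    rw [map_smul]
    have key : ∀ z : K.X i ⟶ A, z ≫ (r • 𝟙 A) = r • z := fun z => by
      rw [Linear.comp_smul, Category.comp_id]
    exact key _
  have := congrArg (fun t => t.unop y) h1
  refine Eq.trans this ?_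
  exact (congrArg (fun t => (K'.homologyι i).unop t) h3).trans
    (map_smul (K'.homologyι i).unop.hom r y)

lemma EXm_smul (i : ℕ) (X A : ModuleCat.{u} R) (r : R) (x : EX i X A) :
    EXm i X (r • 𝟙 A) x = r • x := by
  have h := lIso_nat' (Ftm (r • 𝟙 A)) i X
  have h2 : EXm i X (r • 𝟙 A) x = (lIso (Ft A) i X).hom.unop
    ((LHm (Ftm (r • 𝟙 A)) i (projectiveResolution X).complex).unop ((lIso (Ft A) i X).inv.unop x)) :=
    congrArg (fun (t : ((Ft A).leftDerived i).obj X ⟶ ((Ft A).leftDerived i).obj X) => t.unop x) h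
  rw [h2, LHm_smul, map_smul]
  congr 1
  exact congrArg (fun (t : ((Ft A).leftDerived i).obj X ⟶ ((Ft A).leftDerived i).obj X) => t.unop x) (lIso (Ft A) i X).hom_inv_id

/-- `Ext^0` is Hom. -/
noncomputable def EX0 (X A : ModuleCat.{u} R) : (ModuleCat.of R (X ⟶ A)) ⟶ EX 0 X A :=
  ((Ft A).fromLeftDerivedZero.app X).unop

instance (A : ModuleCat.{u} R) : PreservesFiniteColimits (Ft A) := by
  have : PreservesFiniteLimits ((linearYoneda R (ModuleCat.{u} R)).obj A) := by
    have h : PreservesFiniteLimits ((linearYoneda R (ModuleCat.{u} R)).obj A ⋙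
      forget (ModuleCat.{u} R)) := by
      change PreservesFiniteLimits (yoneda.obj A)
      infer_instance
    exact preservesFiniteLimits_of_reflects_of_preserves _ (forget (ModuleCat.{u} R))
  exact preservesFiniteColimits_rightOp _

lemma EX0_bij (X A : ModuleCat.{u} R) : Function.Bijective (EX0 X A) := by
  have : IsIso (EX0 X A) := by
    have := isIso_unop ((Ft A).fromLeftDerivedZero.app X)
    exact this
  exact ConcreteCategory.bijective_of_isIso (EX0 X A)

lemma EX0_map (X : ModuleCat.{u} R) {A B : ModuleCat.{u} R} (f : A ⟶ B) (x : X ⟶ A) :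
    EXm 0 X f (EX0 X A x) = EX0 X B (x ≫ f : X ⟶ B) :=
  congrArg (fun t => t.unop x) (zero_nat (Ftm f) X)

lemma EX0_res {X X' : ModuleCat.{u} R} (g : X' ⟶ X) (A : ModuleCat.{u} R) (x : X ⟶ A) :
    EXr 0 g A (EX0 X A x) = EX0 X' A (g ≫ x : X' ⟶ A) :=
  congrArg (fun t => t.unop x) ((Ft A).fromLeftDerivedZero.naturality g)

end ExtMod
end LCaux

namespace LCaux
section Colim
variable {R : Type u} [CommRing R] (a : Ideal R)

/-- `R/a^t` -/
abbrev Qo (t : ℕ) : ModuleCat.{u} R := ModuleCat.of R (R ⧸ a ^ t)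

/-- transition map -/
abbrev Qm {s t : ℕ} (h : t ≤ s) : Qo a s ⟶ Qo a t :=
  ModuleCat.ofHom (Submodule.mapQ (a ^ s) (a ^ t) LinearMap.id (Ideal.pow_le_pow_right h))

noncomputable def Dg (i : ℕ) : ℕᵒᵖᵒᵖ ⥤ ModuleCat.{u} R ⥤ ModuleCat.{u} R :=
  localCohomology.diagram (localCohomology.idealPowersDiagram a) i

noncomputable def lcCocone (i : ℕ) : Cocone (Dg a i) :=
  have : HasColimit (Dg a i) := localCohomology.hasColimitDiagram.{u, 0} _ i
  colimit.cocone (Dg a i)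

noncomputable def lcCoconeIs (i : ℕ) : IsColimit (lcCocone a i) :=
  have : HasColimit (Dg a i) := localCohomology.hasColimitDiagram.{u, 0} _ i
  colimit.isColimit (Dg a i)

noncomputable def lcM (i : ℕ) (M : ModuleCat.{u} R) :
    Cocone (Dg a i ⋙ (evaluation (ModuleCat.{u} R) (ModuleCat.{u} R)).obj M) :=
  ((evaluation (ModuleCat.{u} R) (ModuleCat.{u} R)).obj M).mapCocone (lcCocone a i)

noncomputable def lcMIs (i : ℕ) (M : ModuleCat.{u} R) : IsColimit (lcM a i M) :=
  isColimitOfPreserves _ (lcCoconeIs a i)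

/-- local cohomology object -/
noncomputable abbrev LC (i : ℕ) (M : ModuleCat.{u} R) : ModuleCat.{u} R :=
  (localCohomology a i).obj M

noncomputable abbrev LCm (i : ℕ) {A B : ModuleCat.{u} R} (f : A ⟶ B) : LC a i A ⟶ LC a i B :=
  (localCohomology a i).map f

/-- structure maps -/
noncomputable def io (i t : ℕ) (M : ModuleCat.{u} R) : EX i (Qo a t) M ⟶ LC a i M :=
  (lcM a i M).ι.app (Opposite.op (Opposite.op t))

lemma io_res (i : ℕ) {s t : ℕ} (h : t ≤ s) (M : ModuleCat.{u} R) (x : EX i (Qo a t) M) :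
    io a i s M (EXr i (Qm a h) M x) = io a i t M x :=
  congrArg (fun f => f x) ((lcM a i M).w (homOfLE h).op.op)

lemma io_nat (i t : ℕ) {A B : ModuleCat.{u} R} (f : A ⟶ B) (x : EX i (Qo a t) A) :
    LCm a i f (io a i t A x) = io a i t B (EXm i (Qo a t) f x) :=
  (congrArg (fun g => g x)
    (((lcCocone a i).ι.app (Opposite.op (Opposite.op t))).naturality f)).symm

lemma fpres : PreservesColimitsOfShape ℕᵒᵖᵒᵖ (forget (ModuleCat.{u} R)) := by
  have : PreservesFilteredColimitsOfSize.{0, 0} (forget (ModuleCat.{u} R)) :=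
    preservesFilteredColimitsOfSize_shrink.{0, u, 0, u} _
  exact PreservesFilteredColimitsOfSize.preserves_filtered_colimits _

lemma io_surj (i : ℕ) (M : ModuleCat.{u} R) (y : LC a i M) : ∃ t x, io a i t M x = y := by
  have := fpres (R := R)
  obtain ⟨⟨⟨t⟩⟩, x, h⟩ := Concrete.isColimit_exists_rep _ (lcMIs a i M) y
  exact ⟨t, x, h⟩

lemma io_zero (i t : ℕ) (M : ModuleCat.{u} R) (x : EX i (Qo a t) M) (h : io a i t M x = 0) :
    ∃ (s : ℕ) (h : t ≤ s), EXr i (Qm a h) M x = 0 := by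
  have := fpres (R := R)
  obtain ⟨⟨⟨s⟩⟩, f, g, h⟩ := Concrete.isColimit_exists_of_rep_eq _ (lcMIs a i M)
    (i := Opposite.op (Opposite.op t)) (j := Opposite.op (Opposite.op t)) x
    (0 : EX i (Qo a t) M) (h.trans (map_zero (io a i t M).hom).symm)
  refine ⟨s, leOfHom f.unop.unop, ?_⟩
  exact h.trans (map_zero (EXr i (Qm a (leOfHom g.unop.unop)) M).hom)

noncomputable def lcdCocone {S : ShortComplex (ModuleCat.{u} R)} (hS : S.ShortExact) (i : ℕ) :
    Cocone (Dg a i ⋙ (evaluation (ModuleCat.{u} R) (ModuleCat.{u} R)).obj S.X₃) where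
  pt := LC a (i+1) S.X₁
  ι := { app := fun t => EXd hS i (Qo a t.unop.unop) ≫ io a (i+1) t.unop.unop S.X₁
         naturality := by
          intro s t f
          ext x
          have h := leOfHom f.unop.unop
          have h1 := congrArg (fun g => g x) (EXd_nat hS i (Qm a h))
          have h2 := io_res a (i+1) h S.X₁ (EXd hS i (Qo a s.unop.unop) x)
          exact (congrArg (fun z => io a (i+1) t.unop.unop S.X₁ z) h1).symm.trans h2 }

/-- connecting homomorphism -/
noncomputable def lcd {S : ShortComplex (ModuleCat.{u} R)} (hS : S.ShortExact) (i : ℕ) :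
    LC a i S.X₃ ⟶ LC a (i+1) S.X₁ :=
  (lcMIs a i S.X₃).desc (lcdCocone a hS i)

lemma lcd_io {S : ShortComplex (ModuleCat.{u} R)} (hS : S.ShortExact) (i t : ℕ)
    (x : EX i (Qo a t) S.X₃) :
    lcd a hS i (io a i t _ x) = io a (i+1) t _ (EXd hS i (Qo a t) x) := by
  have h := (lcMIs a i S.X₃).fac (lcdCocone a hS i) (Opposite.op (Opposite.op t))
  exact congrArg (fun (g : EX i (Qo a t) S.X₃ ⟶ LC a (i+1) S.X₁) => g x) h

lemma EXr_nat (i : ℕ) {X X' : ModuleCat.{u} R} (g : X' ⟶ X) {A B : ModuleCat.{u} R} (f : A ⟶ B)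
    (x : EX i X A) : EXr i g B (EXm i X f x) = EXm i X' f (EXr i g A x) :=
  congrArg (fun (h : EX i X A ⟶ EX i X' B) => h x)
    (((Ext R (ModuleCat.{u} R) i).map g.op).naturality f)

lemma EXd_nat_apply {S : ShortComplex (ModuleCat.{u} R)} (hS : S.ShortExact) (i : ℕ)
    {X X' : ModuleCat.{u} R} (g : X' ⟶ X) (x : EX i X S.X₃) :
    EXr (i+1) g S.X₁ (EXd hS i X x) = EXd hS i X' (EXr i g S.X₃ x) :=
  congrArg (fun (h : EX i X S.X₃ ⟶ EX (i+1) X' S.X₁) => h x) (EXd_nat hS i g)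

/-- exactness passes to the colimit -/
lemma exact_colim {i j k : ℕ} {A B C : ModuleCat.{u} R}
    (f : LC a i A ⟶ LC a j B) (g : LC a j B ⟶ LC a k C)
    (f' : ∀ t, EX i (Qo a t) A ⟶ EX j (Qo a t) B)
    (g' : ∀ t, EX j (Qo a t) B ⟶ EX k (Qo a t) C)
    (hf : ∀ t x, f (io a i t A x) = io a j t B (f' t x))
    (hg : ∀ t x, g (io a j t B x) = io a k t C (g' t x))
    (hg' : ∀ s t (h : t ≤ s) x, EXr k (Qm a h) C (g' t x) = g' s (EXr j (Qm a h) B x))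
    (he : ∀ t, Function.Exact (f' t) (g' t)) : Function.Exact f g := by
  intro y
  constructor
  · intro hy
    obtain ⟨t, x, rfl⟩ := io_surj a j B y
    rw [hg] at hy
    obtain ⟨s, h, hs⟩ := io_zero a k t C _ hy
    rw [hg'] at hs
    obtain ⟨z, hz⟩ := (he s _).1 hs
    refine ⟨io a i s A z, ?_⟩
    rw [hf, hz, io_res]
  · rintro ⟨z, rfl⟩
    obtain ⟨t, x, rfl⟩ := io_surj a i A z
    rw [hf, hg, (he t).apply_apply_eq_zero, map_zero]

variable {S : ShortComplex (ModuleCat.{u} R)}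

lemma LC_exact₂ (hS : S.ShortExact) (i : ℕ) : Function.Exact (LCm a i S.f) (LCm a i S.g) :=
  exact_colim a _ _ (fun t => EXm i (Qo a t) S.f) (fun t => EXm i (Qo a t) S.g)
    (fun t x => io_nat a i t S.f x) (fun t x => io_nat a i t S.g x)
    (fun _ _ h x => EXr_nat i (Qm a h) S.g x) (fun t => EX_exact₂ hS i (Qo a t))

lemma LC_exact₃ (hS : S.ShortExact) (i : ℕ) : Function.Exact (LCm a i S.g) (lcd a hS i) :=
  exact_colim a _ _ (fun t => EXm i (Qo a t) S.g) (fun t => EXd hS i (Qo a t))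
    (fun t x => io_nat a i t S.g x) (fun t x => lcd_io a hS i t x)
    (fun _ _ h x => EXd_nat_apply hS i (Qm a h) x) (fun t => EX_exact₃ hS i (Qo a t))

lemma LC_exact₁ (hS : S.ShortExact) (i : ℕ) : Function.Exact (lcd a hS i) (LCm a (i+1) S.f) :=
  exact_colim a _ _ (fun t => EXd hS i (Qo a t)) (fun t => EXm (i+1) (Qo a t) S.f)
    (fun t x => lcd_io a hS i t x) (fun t x => io_nat a (i+1) t S.f x)
    (fun _ _ h x => EXr_nat (i+1) (Qm a h) S.f x) (fun t => EX_exact₁ hS i (Qo a t))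

lemma LC_inj (i : ℕ) (E : ModuleCat.{u} R) [Injective E] (y : LC a (i+1) E) : y = 0 := by
  obtain ⟨t, x, rfl⟩ := io_surj a (i+1) E y
  rw [EX_inj i _ E x, map_zero]

lemma LC_smul (i : ℕ) (A : ModuleCat.{u} R) (r : R) (y : LC a i A) : LCm a i (r • 𝟙 A) y = r • y := by
  obtain ⟨t, x, rfl⟩ := io_surj a i A y
  rw [io_nat, EXm_smul, map_smul]

/-- evaluation at one of `Hom(R/a^t, M)` -/
noncomputable def ev1 (t : ℕ) (M : ModuleCat.{u} R) : ModuleCat.of R (Qo a t ⟶ M) →ₗ[R] M where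
  toFun f := (f : Qo a t ⟶ M).hom (Submodule.Quotient.mk 1)
  map_add' _ _ := rfl
  map_smul' _ _ := rfl

noncomputable def ev0 (t : ℕ) (M : ModuleCat.{u} R) : EX 0 (Qo a t) M →ₗ[R] M :=
  (ev1 a t M).comp
    (LinearEquiv.ofBijective (EX0 (Qo a t) M).hom (EX0_bij (Qo a t) M)).symm.toLinearMap

lemma ev0_EX0 (t : ℕ) (M : ModuleCat.{u} R) (f : Qo a t ⟶ M) :
    ev0 a t M (EX0 (Qo a t) M f) = f.hom (Submodule.Quotient.mk 1) := by
  have := LinearEquiv.symm_apply_apply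
    (LinearEquiv.ofBijective (EX0 (Qo a t) M).hom (EX0_bij (Qo a t) M)) f
  exact congrArg (ev1 a t M) this

noncomputable def ev0Cocone (M : ModuleCat.{u} R) :
    Cocone (Dg a 0 ⋙ (evaluation (ModuleCat.{u} R) (ModuleCat.{u} R)).obj M) where
  pt := M
  ι := { app := fun t => ModuleCat.ofHom (ev0 a t.unop.unop M)
         naturality := by
          intro s t f
          ext x
          obtain ⟨φ, rfl⟩ := (EX0_bij (Qo a s.unop.unop) M).2 x
          have h := leOfHom f.unop.unop
          have h1 := EX0_res (Qm a h) M φ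
          refine (congrArg (ev0 a t.unop.unop M) h1).trans ?_
          rw [ev0_EX0]
          exact (ev0_EX0 a _ M φ).symm }

/-- `H^0_a(M) → M` -/
noncomputable def jM (M : ModuleCat.{u} R) : LC a 0 M ⟶ M :=
  (lcMIs a 0 M).desc (ev0Cocone a M)

lemma jM_io (t : ℕ) (M : ModuleCat.{u} R) (f : Qo a t ⟶ M) :
    jM a M (io a 0 t M (EX0 (Qo a t) M f)) = f.hom (Submodule.Quotient.mk 1) := by
  have h := (lcMIs a 0 M).fac (ev0Cocone a M) (Opposite.op (Opposite.op t))
  exact (congrArg (fun (g : EX 0 (Qo a t) M ⟶ M) => g (EX0 (Qo a t) M f)) h).trans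
    (ev0_EX0 a t M f)

lemma jM_nat {A B : ModuleCat.{u} R} (f : A ⟶ B) (y : LC a 0 A) :
    jM a B (LCm a 0 f y) = f (jM a A y) := by
  obtain ⟨t, x, rfl⟩ := io_surj a 0 A y
  obtain ⟨φ, rfl⟩ := (EX0_bij (Qo a t) A).2 x
  rw [io_nat, EX0_map, jM_io, jM_io]
  rfl

lemma jM_inj (M : ModuleCat.{u} R) : Function.Injective (jM a M) := by
  rw [injective_iff_map_eq_zero]
  intro y hy
  obtain ⟨t, x, rfl⟩ := io_surj a 0 M y
  obtain ⟨φ, rfl⟩ := (EX0_bij (Qo a t) M).2 x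
  rw [jM_io] at hy
  have : φ = 0 := by
    refine ModuleCat.hom_ext (LinearMap.ext fun x => ?_)
    obtain ⟨r, rfl⟩ := Submodule.Quotient.mk_surjective _ x
    have h : (Submodule.Quotient.mk r : R ⧸ a ^ t) = r • Submodule.Quotient.mk 1 := by
      rw [← Submodule.Quotient.mk_smul, smul_eq_mul, mul_one]
    rw [h, map_smul]
    exact (congrArg (r • ·) hy).trans (smul_zero _)
  subst this
  exact (congrArg _ (map_zero (EX0 (Qo a t) M).hom)).trans (map_zero _)

lemma jM_range (M : ModuleCat.{u} R) (m : M) :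
    (∃ y, jM a M y = m) ↔ ∃ t, ∀ r ∈ a ^ t, r • m = 0 := by
  constructor
  · rintro ⟨y, rfl⟩
    obtain ⟨t, x, rfl⟩ := io_surj a 0 M y
    obtain ⟨φ, rfl⟩ := (EX0_bij (Qo a t) M).2 x
    refine ⟨t, fun r hr => ?_⟩
    rw [jM_io]
    have : (Submodule.Quotient.mk r : R ⧸ a ^ t) = 0 := (Submodule.Quotient.mk_eq_zero _).2 hr
    have h : (Submodule.Quotient.mk r : R ⧸ a ^ t) = r • Submodule.Quotient.mk 1 := by
      rw [← Submodule.Quotient.mk_smul, smul_eq_mul, mul_one]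
    have h2 : r • φ.hom (Submodule.Quotient.mk 1) =
      φ.hom (r • (Submodule.Quotient.mk 1 : R ⧸ a ^ t)) := (map_smul φ.hom r _).symm
    refine h2.trans ?_
    rw [← h, this, map_zero]
  · rintro ⟨t, ht⟩
    let φ : Qo a t ⟶ M := ModuleCat.ofHom
      (Submodule.liftQ (a ^ t) (LinearMap.toSpanSingleton R M m) (fun r hr => by
        exact ht r hr))
    refine ⟨io a 0 t M (EX0 (Qo a t) M φ), ?_⟩
    rw [jM_io]
    exact one_smul R m

end Colim
end LCaux

namespace LCaux
section Iface
variable {R : Type u} [CommRing R] (a : Ideal R)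
variable {A B C : Type u} [AddCommGroup A] [Module R A] [AddCommGroup B] [Module R B]
  [AddCommGroup C] [Module R C]

/-- induced map on local cohomology -/
noncomputable def Hm (i : ℕ) (f : A →ₗ[R] B) : locH R a i A →ₗ[R] locH R a i B :=
  (LCm a i (ModuleCat.ofHom f)).hom

lemma Hm_comp (i : ℕ) (f : A →ₗ[R] B) (g : B →ₗ[R] C) (x : locH R a i A) :
    Hm a i (g.comp f) x = Hm a i g (Hm a i f x) :=
  congrArg (fun t => t x) ((localCohomology a i).map_comp (ModuleCat.ofHom f) (ModuleCat.ofHom g))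

lemma Hm_smul (i : ℕ) (r : R) (x : locH R a i A) :
    Hm a i (r • (LinearMap.id : A →ₗ[R] A)) x = r • x :=
  LC_smul a i (ModuleCat.of R A) r x

lemma Hm_id (i : ℕ) (x : locH R a i A) : Hm a i (LinearMap.id : A →ₗ[R] A) x = x :=
  congrArg (fun t => t x) ((localCohomology a i).map_id (ModuleCat.of R A))

lemma Hm_zero (i : ℕ) (x : locH R a i A) : Hm a i (0 : A →ₗ[R] B) x = 0 := by
  have h : (0 : A →ₗ[R] B) = (0 : A →ₗ[R] B).comp ((0 : R) • (LinearMap.id : A →ₗ[R] A)) := by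
    simp
  rw [h, Hm_comp, Hm_smul, zero_smul, map_zero]

lemma H_subsingleton (i : ℕ) [Subsingleton A] (x : locH R a i A) : x = 0 := by
  have h : (LinearMap.id : A →ₗ[R] A) = 0 := Subsingleton.elim _ _
  rw [← Hm_id a i x, h, Hm_zero]

lemma mkSE {f : A →ₗ[R] B} {g : B →ₗ[R] C} (hf : Function.Injective f)
    (hg : Function.Surjective g) (h : Function.Exact f g) :
    (ShortComplex.mk (ModuleCat.ofHom f) (ModuleCat.ofHom g)
      (by ext x; exact h.apply_apply_eq_zero x)).ShortExact := by
  refine ShortComplex.ShortExact.mk' ?_ ?_ ?_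
  · exact (ShortComplex.ShortExact.moduleCat_exact_iff_function_exact _).2 h
  · exact (ModuleCat.mono_iff_injective _).2 hf
  · exact (ModuleCat.epi_iff_surjective _).2 hg

lemma les₂ {f : A →ₗ[R] B} {g : B →ₗ[R] C} (hf : Function.Injective f)
    (hg : Function.Surjective g) (h : Function.Exact f g) (i : ℕ) :
    Function.Exact (Hm a i f) (Hm a i g) := LC_exact₂ a (mkSE hf hg h) i

lemma les {f : A →ₗ[R] B} {g : B →ₗ[R] C} (hf : Function.Injective f)
    (hg : Function.Surjective g) (h : Function.Exact f g) (i : ℕ) :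
    ∃ δ : locH R a i C →ₗ[R] locH R a (i+1) A,
      Function.Exact (Hm a i g) δ ∧ Function.Exact δ (Hm a (i+1) f) :=
  ⟨(lcd a (mkSE hf hg h) i).hom, LC_exact₃ a (mkSE hf hg h) i, LC_exact₁ a (mkSE hf hg h) i⟩

lemma H_inj (i : ℕ) (E : Type u) [AddCommGroup E] [Module R E] [Module.Injective R E]
    (x : locH R a (i+1) E) : x = 0 := by
  have : Injective (ModuleCat.of R E) := Module.injective_object_of_injective_module R E
  exact LC_inj a i (ModuleCat.of R E) x

/-- `H^0_a(M) → M` -/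
noncomputable def jj (A : Type u) [AddCommGroup A] [Module R A] : locH R a 0 A →ₗ[R] A :=
  (jM a (ModuleCat.of R A)).hom

lemma jj_nat (f : A →ₗ[R] B) (x : locH R a 0 A) : jj a B (Hm a 0 f x) = f (jj a A x) :=
  jM_nat a (ModuleCat.ofHom f) x

lemma jj_inj : Function.Injective (jj a A) := jM_inj a (ModuleCat.of R A)

/-- the `a`-torsion submodule -/
def tors (A : Type u) [AddCommGroup A] [Module R A] : Submodule R A where
  carrier := {m | ∃ t : ℕ, ∀ r ∈ a ^ t, r • m = 0}
  zero_mem' := ⟨0, by simp⟩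
  add_mem' := by
    rintro x y ⟨s, hs⟩ ⟨t, ht⟩
    refine ⟨s + t, fun r hr => ?_⟩
    rw [smul_add, hs r (Ideal.pow_le_pow_right (by lia) hr),
      ht r (Ideal.pow_le_pow_right (by lia) hr), add_zero]
  smul_mem' := by
    rintro c x ⟨s, hs⟩
    exact ⟨s, fun r hr => by rw [smul_comm, hs r hr, smul_zero]⟩

variable {a} in
lemma mem_tors {m : A} : m ∈ tors a A ↔ ∃ t : ℕ, ∀ r ∈ a ^ t, r • m = 0 := Iff.rfl

lemma jj_range : LinearMap.range (jj a A) = tors a A := by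
  ext m
  exact jM_range a (ModuleCat.of R A) m

/-- `H^0_a(M) ≃ Γ_a(M)` -/
noncomputable def jE (A : Type u) [AddCommGroup A] [Module R A] : locH R a 0 A ≃ₗ[R] tors a A :=
  (LinearEquiv.ofInjective (jj a A) (jj_inj a)).trans (LinearEquiv.ofEq _ _ (jj_range a))

lemma exists_inj (A : Type u) [AddCommGroup A] [Module R A] :
    ∃ (E : Type u) (_ : AddCommGroup E) (_ : Module R E) (_ : Module.Injective R E)
      (f : A →ₗ[R] E), Function.Injective f := by
  let J := (EnoughInjectives.presentation (ModuleCat.of R A)).some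
  have := J.injective
  refine ⟨J.J, inferInstance, inferInstance, Module.injective_module_of_injective_object R J.J,
    J.f.hom, (ModuleCat.mono_iff_injective _).1 J.mono⟩

end Iface

end LCaux

namespace LCaux
section Alg
variable {R : Type u} [CommRing R] (a : Ideal R)
variable {A B C : Type u} [AddCommGroup A] [Module R A] [AddCommGroup B] [Module R B]
  [AddCommGroup C] [Module R C]

def IsTors (A : Type u) [AddCommGroup A] [Module R A] : Prop := ∀ m : A, m ∈ tors a A

variable {a} in
lemma IsTors.map {f : A →ₗ[R] B} (hf : Function.Surjective f) (h : IsTors a A) : IsTors a B := by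
  intro b
  obtain ⟨x, rfl⟩ := hf b
  obtain ⟨t, ht⟩ := h x
  exact ⟨t, fun r hr => by rw [← map_smul, ht r hr, map_zero]⟩

lemma isTors_tors : IsTors a (tors a A) := by
  rintro ⟨x, t, ht⟩
  exact ⟨t, fun r hr => Subtype.ext (ht r hr)⟩

/-- finitely generated torsion is killed by a power -/
lemma fg_tors (N : Submodule R A) (hN : N.FG) (h : N ≤ tors a A) :
    ∃ t : ℕ, ∀ r ∈ a ^ t, ∀ x ∈ N, r • x = 0 := by
  obtain ⟨s, rfl⟩ := hN
  have h1 : ∀ x ∈ s, ∃ t : ℕ, ∀ r ∈ a ^ t, r • x = 0 := fun x hx => h (Submodule.subset_span hx)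
  choose! t ht using h1
  refine ⟨s.sup t, fun r hr x hx => ?_⟩
  induction hx using Submodule.span_induction with
  | mem x hx => exact ht x hx r (Ideal.pow_le_pow_right (Finset.le_sup hx) hr)
  | zero => simp
  | add x y _ _ hx hy => rw [smul_add, hx, hy, add_zero]
  | smul c x _ hx => rw [smul_comm, hx, smul_zero]

lemma tors_injective [IsNoetherianRing R] (E : Type u) [AddCommGroup E] [Module R E]
    [hE : Module.Injective R E] : Module.Injective R (tors a E) := by
  apply Module.Baer.injective
  intro I g
  obtain ⟨t, ht⟩ := fg_tors a (LinearMap.range ((tors a E).subtype.comp g))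
    (by rw [LinearMap.range_eq_map]; exact Submodule.FG.map _ (IsNoetherian.noetherian _))
    (by rintro _ ⟨x, rfl⟩; exact (g x).2)
  obtain ⟨k, hk⟩ := Ideal.exists_pow_inf_eq_pow_smul a (I : Submodule R R)
  have hk' := hk (k + t) (by lia)
  let φ : I →ₗ[R] R ⧸ a ^ (k + t) := (Submodule.mkQ (a ^ (k+t))).comp (Submodule.subtype I)
  have hφ : LinearMap.ker φ ≤ LinearMap.ker ((tors a E).subtype.comp g) := by
    intro x hx
    have hx1 : (x : R) ∈ a ^ (k + t) := by
      rw [LinearMap.mem_ker] at hx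
      exact (Submodule.Quotient.mk_eq_zero _).1 hx
    have hx2 : (x : R) ∈ a ^ t • (I : Submodule R R) := by
      have : (x : R) ∈ a ^ (k+t) • (⊤ : Submodule R R) ⊓ I := ⟨by simpa using hx1, x.2⟩
      rw [hk', Nat.add_sub_cancel_left] at this
      exact Submodule.smul_mono le_rfl inf_le_right this
    have : ∀ y (hy : y ∈ a ^ t • (I : Submodule R R)), ∃ h : y ∈ I, (g ⟨y, h⟩ : E) = 0 := by
      intro y hy
      induction hy using Submodule.smul_induction_on' with
      | smul r hr n hn =>
        refine ⟨I.smul_mem r hn, ?_⟩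
        have h1 := ht r hr (g ⟨n, hn⟩) ⟨⟨n, hn⟩, rfl⟩
        rw [← Submodule.coe_smul, ← map_smul] at h1
        exact h1
      | add x hx y hy h1 h2 =>
        obtain ⟨h1, h1'⟩ := h1
        obtain ⟨h2, h2'⟩ := h2
        refine ⟨I.add_mem h1 h2, ?_⟩
        have : (⟨x + y, I.add_mem h1 h2⟩ : I) = ⟨x, h1⟩ + ⟨y, h2⟩ := rfl
        rw [this, map_add, Submodule.coe_add, h1', h2', add_zero]
    obtain ⟨_, h⟩ := this x hx2
    exact h
  obtain ⟨h, hh⟩ := hE.out ((LinearMap.ker φ).liftQ φ le_rfl)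
    (LinearMap.ker_eq_bot.1 (Submodule.ker_liftQ_eq_bot _ _ _ le_rfl))
    ((LinearMap.ker φ).liftQ ((tors a E).subtype.comp g) hφ)
  refine ⟨LinearMap.codRestrict (tors a E) (h.comp (Submodule.mkQ (a ^ (k+t)))) ?_, ?_⟩
  · intro r
    refine ⟨k + t, fun s hs => ?_⟩
    rw [← map_smul, LinearMap.comp_apply]
    have : Submodule.mkQ (a ^ (k+t)) (s • r) = 0 :=
      (Submodule.Quotient.mk_eq_zero _).2 (Ideal.mul_mem_right r _ hs)
    rw [this, map_zero]
  · intro x hx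
    apply Subtype.ext
    have := hh (Submodule.Quotient.mk ⟨x, hx⟩)
    exact this

lemma les_quot {f : A →ₗ[R] B} (_ : Function.Injective f) :
    Function.Surjective (LinearMap.range f).mkQ ∧ Function.Exact f (LinearMap.range f).mkQ :=
  ⟨Submodule.mkQ_surjective _, fun y => by
    rw [Submodule.mkQ_apply, Submodule.Quotient.mk_eq_zero]; rfl⟩

lemma torsion_embed [IsNoetherianRing R] (h : IsTors a A) :
    ∃ (E : Type u) (_ : AddCommGroup E) (_ : Module R E) (_ : Module.Injective R E)
      (f : A →ₗ[R] E), Function.Injective f ∧ IsTors a E := by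
  obtain ⟨E, _, _, _, f, hf⟩ := exists_inj (R := R) A
  refine ⟨tors a E, inferInstance, inferInstance, tors_injective a E,
    LinearMap.codRestrict (tors a E) f ?_, ?_, isTors_tors a⟩
  · intro x
    obtain ⟨t, ht⟩ := h x
    exact ⟨t, fun r hr => by rw [← map_smul, ht r hr, map_zero]⟩
  · intro x y hxy
    exact hf (congrArg Subtype.val hxy)

lemma torsion_vanish [IsNoetherianRing R] (i : ℕ) : ∀ (A : Type u) [AddCommGroup A] [Module R A],
    IsTors a A → ∀ x : locH R a (i+1) A, x = 0 := by
  induction i with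
  | zero =>
    intro A _ _ h x
    obtain ⟨E, _, _, _, f, hf, hE⟩ := torsion_embed a h
    obtain ⟨hs, he⟩ := les_quot hf
    obtain ⟨δ, h1, h2⟩ := les a hf hs he 0
    obtain ⟨y, rfl⟩ := (h2 x).1 (H_inj a 0 E _)
    apply (h1 y).2
    obtain ⟨z, hz⟩ := hs (jj a _ y)
    obtain ⟨w, hw⟩ : z ∈ LinearMap.range (jj a E) := by rw [jj_range]; exact hE z
    refine ⟨w, jj_inj a ?_⟩
    rw [jj_nat, hw, hz]
  | succ i ih =>
    intro A _ _ h x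
    obtain ⟨E, _, _, _, f, hf, hE⟩ := torsion_embed a h
    obtain ⟨hs, he⟩ := les_quot hf
    obtain ⟨δ, h1, h2⟩ := les a hf hs he (i+1)
    obtain ⟨y, rfl⟩ := (h2 x).1 (H_inj a (i+1) E _)
    rw [ih _ (hE.map hs) y, map_zero]

lemma H_isTors (i : ℕ) : ∀ (A : Type u) [AddCommGroup A] [Module R A],
    IsTors a (locH R a i A) := by
  induction i with
  | zero =>
    intro A _ _ x
    have : jj a A x ∈ tors a A := by rw [← jj_range]; exact ⟨x, rfl⟩
    obtain ⟨t, ht⟩ := this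
    exact ⟨t, fun r hr => jj_inj a (by rw [map_smul, ht r hr, map_zero])⟩
  | succ i ih =>
    intro A _ _
    obtain ⟨E, _, _, _, f, hf⟩ := exists_inj (R := R) A
    obtain ⟨hs, he⟩ := les_quot hf
    obtain ⟨δ, h1, h2⟩ := les a hf hs he i
    exact (ih _).map (f := δ) fun x => (h2 x).1 (H_inj a i E _)

end Alg

end LCaux

namespace LCaux
section Loc
variable {R : Type u} [CommRing R] (a : Ideal R) (S : Submonoid R)
variable {A B C : Type u} [AddCommGroup A] [Module R A] [AddCommGroup B] [Module R B]
  [AddCommGroup C] [Module R C]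

/-- localization of a linear map -/
noncomputable def mp (f : A →ₗ[R] B) : LocalizedModule S A →ₗ[Localization S] LocalizedModule S B :=
  IsLocalizedModule.mapExtendScalars S (LocalizedModule.mkLinearMap S A)
    (LocalizedModule.mkLinearMap S B) (Localization S) f

lemma mp_mk (f : A →ₗ[R] B) (x : A) (s : S) :
    mp S f (LocalizedModule.mk x s) = LocalizedModule.mk (f x) s :=
  IsLocalizedModule.map_LocalizedModules S f x s

lemma mp_exact {f : A →ₗ[R] B} {g : B →ₗ[R] C} (h : Function.Exact f g) :
    Function.Exact (mp S f) (mp S g) := LocalizedModule.map_exact S f g h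

lemma mp_inj {f : A →ₗ[R] B} (h : Function.Injective f) : Function.Injective (mp S f) :=
  IsLocalizedModule.map_injective S _ _ f h

lemma mp_surj {f : A →ₗ[R] B} (h : Function.Surjective f) : Function.Surjective (mp S f) :=
  IsLocalizedModule.map_surjective S _ _ f h

lemma mp_comp (f : A →ₗ[R] B) (g : B →ₗ[R] C) (x : LocalizedModule S A) :
    mp S (g.comp f) x = mp S g (mp S f x) := by
  induction x using LocalizedModule.induction_on with
  | h x s => simp [mp_mk]

lemma mem_tors_loc [IsNoetherianRing R] (x : LocalizedModule S A) :
    x ∈ tors (a.map (algebraMap R (Localization S))) (LocalizedModule S A) ↔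
      ∃ (m : A) (s : S), m ∈ tors a A ∧ x = LocalizedModule.mk m s := by
  constructor
  · rintro ⟨t, ht⟩
    induction x using LocalizedModule.induction_on with
    | h m s =>
    obtain ⟨F, hF⟩ := IsNoetherian.noetherian (a ^ t)
    have h1 : ∀ r ∈ F, ∃ v : S, v • (r • m) = 0 := by
      intro r hr
      have h2 : algebraMap R (Localization S) r ∈ (a.map (algebraMap R (Localization S))) ^ t := by
        rw [← Ideal.map_pow]
        exact Ideal.mem_map_of_mem _ (hF ▸ Submodule.subset_span hr)
      have h3 := ht _ h2
      rw [algebraMap_smul, LocalizedModule.smul'_mk, ← LocalizedModule.zero_mk (1 : S),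
        LocalizedModule.mk_eq] at h3
      obtain ⟨v, hv⟩ := h3
      refine ⟨v, ?_⟩
      simpa using hv
    choose! v hv using h1
    classical
    let w : S := ∏ r ∈ F, v r
    refine ⟨w • m, w * s, ⟨t, ?_⟩, ?_⟩
    · intro r hr
      rw [← hF] at hr
      induction hr using Submodule.span_induction with
      | mem r hr =>
        have : w = (∏ r ∈ F.erase r, v r) * v r := (Finset.prod_erase_mul F v hr).symm
        rw [this, mul_smul, smul_comm r, smul_comm r, hv r hr, smul_zero]
      | zero => simp
      | add x y _ _ hx hy => rw [add_smul, hx, hy, add_zero]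
      | smul c x _ hx => rw [smul_assoc, hx, smul_zero]
    · exact (LocalizedModule.mk_cancel_common_left w s m).symm
  · rintro ⟨m, s, ⟨t, ht⟩, rfl⟩
    refine ⟨t, fun r hr => ?_⟩
    rw [← Ideal.map_pow] at hr
    have : ∀ r ∈ Ideal.map (algebraMap R (Localization S)) (a ^ t),
        r • (LocalizedModule.mk m s) = 0 := by
      intro r hr
      induction hr using Submodule.span_induction with
      | mem r hr =>
        obtain ⟨r, hr, rfl⟩ := hr
        rw [algebraMap_smul, LocalizedModule.smul'_mk, ht r hr, LocalizedModule.zero_mk]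
      | zero => simp
      | add x y _ _ hx hy => rw [add_smul, hx, hy, add_zero]
      | smul c x _ hx => rw [smul_assoc, hx, smul_zero]
    exact this r hr

/-- comparison in degree zero -/
lemma loc_zero [IsNoetherianRing R] (A : Type u) [AddCommGroup A] [Module R A] :
    ∃ e : LocalizedModule S (locH R a 0 A) ≃ₗ[Localization S]
      locH (Localization S) (a.map (algebraMap R (Localization S))) 0 (LocalizedModule S A),
      ∀ x, jj _ _ (e x) = mp S (jj a A) x := by
  let a' := a.map (algebraMap R (Localization S))
  have hr : LinearMap.range (mp S (jj a A)) = LinearMap.range (jj a' (LocalizedModule S A)) := by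
    ext x
    rw [jj_range, mem_tors_loc]
    constructor
    · rintro ⟨y, rfl⟩
      induction y using LocalizedModule.induction_on with
      | h y s => exact ⟨jj a A y, s, by rw [← jj_range]; exact ⟨y, rfl⟩, mp_mk S _ _ _⟩
    · rintro ⟨m, s, hm, rfl⟩
      rw [← jj_range] at hm
      obtain ⟨y, rfl⟩ := hm
      exact ⟨LocalizedModule.mk y s, mp_mk S _ _ _⟩
  let e1 := LinearEquiv.ofInjective (mp S (jj a A)) (mp_inj S (jj_inj a))
  let e2 := LinearEquiv.ofInjective (jj a' (LocalizedModule S A)) (jj_inj a')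
  refine ⟨(e1.trans (LinearEquiv.ofEq _ _ hr)).trans e2.symm, fun x => ?_⟩
  have h3 : ∀ y : LinearMap.range (jj a' (LocalizedModule S A)), jj a' _ (e2.symm y) = y := by
    intro y
    have := congrArg Subtype.val (e2.apply_symm_apply y)
    exact this
  exact h3 _

/-- comparison of cokernels -/
lemma coker_equiv {R : Type u} [CommRing R] {A B C A' B' C' : Type u}
    [AddCommGroup A] [Module R A] [AddCommGroup B] [Module R B] [AddCommGroup C] [Module R C]
    [AddCommGroup A'] [Module R A'] [AddCommGroup B'] [Module R B'] [AddCommGroup C'] [Module R C']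
    {f : A →ₗ[R] B} {g : B →ₗ[R] C} {f' : A' →ₗ[R] B'} {g' : B' →ₗ[R] C'}
    (h : Function.Exact f g) (hg : Function.Surjective g)
    (h' : Function.Exact f' g') (hg' : Function.Surjective g')
    (eA : A ≃ₗ[R] A') (eB : B ≃ₗ[R] B') (hc : ∀ x, eB (f x) = f' (eA x)) :
    Nonempty (C ≃ₗ[R] C') := by
  have hk : (LinearMap.ker g).map (eB : B →ₗ[R] B') = LinearMap.ker g' := by
    rw [h.linearMap_ker_eq, h'.linearMap_ker_eq]
    ext y
    constructor
    · rintro ⟨_, ⟨x, rfl⟩, rfl⟩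
      exact ⟨eA x, (hc x).symm⟩
    · rintro ⟨x, rfl⟩
      exact ⟨f (eA.symm x), ⟨_, rfl⟩, by simp [hc]⟩
  exact ⟨(g.quotKerEquivOfSurjective hg).symm.trans
    ((Submodule.Quotient.equiv _ _ eB hk).trans (g'.quotKerEquivOfSurjective hg'))⟩

/-- the comparison isomorphism -/
lemma loc_iso [IsNoetherianRing R] (i : ℕ) : ∀ (A : Type u) [AddCommGroup A] [Module R A],
    Nonempty (LocalizedModule S (locH R a i A) ≃ₗ[Localization S]
      locH (Localization S) (a.map (algebraMap R (Localization S))) i (LocalizedModule S A)) := by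
  have aux : ∀ (A : Type u) [AddCommGroup A] [Module R A] (i : ℕ),
    ∃ (E C : Type u) (_ : AddCommGroup E) (_ : Module R E) (_ : AddCommGroup C) (_ : Module R C)
      (g : E →ₗ[R] C)
      (δ : locH R a i C →ₗ[R] locH R a (i+1) A)
      (δ' : locH (Localization S) (a.map (algebraMap R (Localization S))) i (LocalizedModule S C)
        →ₗ[Localization S]
        locH (Localization S) (a.map (algebraMap R (Localization S))) (i+1) (LocalizedModule S A)),
      Function.Exact (Hm a i g) δ ∧ Function.Surjective δ ∧
      Function.Exact (Hm (a.map (algebraMap R (Localization S))) i (mp S g)) δ' ∧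
      Function.Surjective δ' ∧ (∀ j, ∀ x : locH R a (j+1) E, x = 0) ∧
      (∀ j, ∀ x : locH (Localization S) (a.map (algebraMap R (Localization S))) (j+1)
        (LocalizedModule S E), x = 0) := by
    intro A _ _ i
    obtain ⟨E, _, _, _, f, hf⟩ := exists_inj (R := R) A
    obtain ⟨hs, he⟩ := les_quot hf
    obtain ⟨δ, h1, h2⟩ := les a hf hs he i
    obtain ⟨δ', h1', h2'⟩ := les (a.map (algebraMap R (Localization S))) (mp_inj S hf)
      (mp_surj S hs) (mp_exact S he) i
    have : Module.Injective (Localization S) (LocalizedModule S E) :=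
      Module.injective_of_isLocalizedModule S (LocalizedModule.mkLinearMap S E)
    exact ⟨E, _, inferInstance, inferInstance, inferInstance, inferInstance, _, δ, δ', h1,
      fun x => (h2 x).1 (H_inj a i E _), h1', fun x => (h2' x).1 (H_inj _ i _ _),
      fun j x => H_inj _ j _ x, fun j x => H_inj _ j _ x⟩
  induction i with
  | zero =>
    intro A _ _
    obtain ⟨e, _⟩ := loc_zero a S A
    exact ⟨e⟩
  | succ i ih =>
    intro A _ _
    obtain ⟨E, C, _, _, _, _, g, δ, δ', h1, h2, h1', h2', h3, h3'⟩ := aux A i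
    obtain _ | i := i
    · obtain ⟨eE, hE⟩ := loc_zero a S E
      obtain ⟨eC, hC⟩ := loc_zero a S C
      refine coker_equiv (mp_exact S h1) (mp_surj S h2) h1' h2' eE eC ?_
      intro x
      apply jj_inj
      rw [hC, jj_nat, hE, ← mp_comp, ← mp_comp]
      congr 2
      ext y
      exact jj_nat a g y
    · obtain ⟨eC⟩ := ih C
      have hz : Function.Exact (0 : (LocalizedModule S C) →ₗ[Localization S] _) (mp S δ) := by
        intro y
        constructor
        · intro hy
          obtain ⟨z, rfl⟩ := (mp_exact S h1 y).1 hy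
          refine ⟨0, ?_⟩
          rw [LinearMap.zero_apply]
          induction z using LocalizedModule.induction_on with
          | h z s => rw [h3 i z, LocalizedModule.zero_mk, map_zero]
        · rintro ⟨x, rfl⟩
          simp
      have hz' : Function.Exact (0 : (LocalizedModule S C) →ₗ[Localization S] _) δ' := by
        intro y
        constructor
        · intro hy
          obtain ⟨z, rfl⟩ := (h1' y).1 hy
          refine ⟨0, ?_⟩
          rw [LinearMap.zero_apply, h3' i z, map_zero]
        · rintro ⟨x, rfl⟩
          simp
      exact coker_equiv hz (mp_surj S h2) hz' h2' (LinearEquiv.refl _ _) eC (by simp)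

end Loc

end LCaux

namespace LCaux
section Serre
variable {R : Type u} [CommRing R] (W : Set (PrimeSpectrum R))
variable {A B C : Type u} [AddCommGroup A] [Module R A] [AddCommGroup B] [Module R B]
  [AddCommGroup C] [Module R C]

/-- finitely generated up to something supported outside `W` -/
def Sc (A : Type u) [AddCommGroup A] [Module R A] : Prop :=
  ∃ N : Submodule R A, N.FG ∧ ∀ p ∈ W, ∀ x : A, ∃ r ∉ p.asIdeal, r • x ∈ N

/-- supported outside `W` -/
def Sm (A : Type u) [AddCommGroup A] [Module R A] : Prop :=
  ∀ p ∈ W, ∀ x : A, ∃ r ∉ p.asIdeal, r • x = 0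

variable {W}

lemma one_notMem_prime (p : PrimeSpectrum R) : (1 : R) ∉ p.asIdeal :=
  (Ideal.ne_top_iff_one _).1 p.isPrime.ne_top

lemma Sc_of_finite [Module.Finite R A] : Sc W A :=
  ⟨⊤, Module.Finite.fg_top, fun p _ _ => ⟨1, one_notMem_prime p, trivial⟩⟩

lemma Sc_of_Sm (h : Sm W A) : Sc W A :=
  ⟨⊥, Submodule.fg_bot, fun p hp x => by
    obtain ⟨r, hr, h⟩ := h p hp x
    exact ⟨r, hr, h⟩⟩

lemma Sc_inj [IsNoetherianRing R] (f : A →ₗ[R] B) (hf : Function.Injective f) (h : Sc W B) :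
    Sc W A := by
  obtain ⟨N, hN, h⟩ := h
  refine ⟨N.comap f, ?_, fun p hp x => ?_⟩
  · have : Module.Finite R N := Module.Finite.iff_fg.2 hN
    have : IsNoetherian R N := isNoetherian_of_isNoetherianRing_of_finite R N
    let g : N.comap f →ₗ[R] N := f.restrict (fun _ hx => hx)
    have hg : Function.Injective g := fun x y hxy => Subtype.ext (hf (congrArg Subtype.val hxy))
    exact Module.Finite.iff_fg.1 (Module.Finite.of_injective g hg)
  · obtain ⟨r, hr, h⟩ := h p hp (f x)
    exact ⟨r, hr, by rwa [Submodule.mem_comap, map_smul]⟩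

lemma Sc_surj (f : A →ₗ[R] B) (hf : Function.Surjective f) (h : Sc W A) : Sc W B := by
  obtain ⟨N, hN, h⟩ := h
  refine ⟨N.map f, hN.map f, fun p hp x => ?_⟩
  obtain ⟨x, rfl⟩ := hf x
  obtain ⟨r, hr, h⟩ := h p hp x
  exact ⟨r, hr, ⟨r • x, h, by simp⟩⟩

lemma exists_lift_fg (g : B →ₗ[R] C) (N : Submodule R C) (hN : N.FG)
    (h : N ≤ LinearMap.range g) : ∃ L : Submodule R B, L.FG ∧ L.map g = N := by
  classical
  obtain ⟨s, rfl⟩ := hN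
  have : ∀ x ∈ s, ∃ y, g y = x := fun x hx => h (Submodule.subset_span hx)
  choose! v hv using this
  refine ⟨Submodule.span R (s.image v), ⟨_, rfl⟩, ?_⟩
  rw [Submodule.map_span]
  congr 1
  ext y
  constructor
  · rintro ⟨z, hz, rfl⟩
    obtain ⟨x, hx, rfl⟩ := Finset.mem_image.1 hz
    rw [hv x hx]
    exact hx
  · intro hy
    exact ⟨v y, Finset.mem_image_of_mem v hy, hv y hy⟩

lemma Sc_ext [IsNoetherianRing R] {f : A →ₗ[R] B} {g : B →ₗ[R] C} (he : Function.Exact f g)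
    (hA : Sc W A) (hC : Sc W C) : Sc W B := by
  obtain ⟨NA, hNA, hA⟩ := hA
  obtain ⟨NC, hNC, hC⟩ := hC
  have hfg : (NC ⊓ LinearMap.range g).FG := by
    have : Module.Finite R NC := Module.Finite.iff_fg.2 hNC
    have : IsNoetherian R NC := isNoetherian_of_isNoetherianRing_of_finite R NC
    exact isNoetherian_submodule.1 this _ inf_le_left
  obtain ⟨L, hL, hLe⟩ := exists_lift_fg g _ hfg inf_le_right
  refine ⟨NA.map f ⊔ L, (hNA.map f).sup hL, fun p hp b => ?_⟩
  obtain ⟨r, hr, h1⟩ := hC p hp (g b)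
  have h2 : r • g b ∈ L.map g := by
    rw [hLe]
    exact ⟨h1, ⟨r • b, by simp⟩⟩
  obtain ⟨l, hl, hl'⟩ := h2
  obtain ⟨x, hx⟩ := (he (r • b - l)).1 (by rw [map_sub, map_smul, hl', sub_self])
  obtain ⟨s, hs, h3⟩ := hA p hp x
  refine ⟨s * r, fun h => (p.isPrime.mem_or_mem h).elim hs hr, ?_⟩
  have : (s * r) • b = f (s • x) + s • l := by
    rw [map_smul, hx, smul_sub, mul_smul]; abel
  rw [this]
  exact Submodule.add_mem_sup ⟨_, h3, rfl⟩ (L.smul_mem s hl)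

lemma Sc_pi {ι : Type} [Fintype ι] (h : Sc W A) : Sc W (ι → A) := by
  classical
  obtain ⟨N, hN, h⟩ := h
  refine ⟨Submodule.pi Set.univ (fun _ => N), Submodule.fg_pi (fun _ => hN), fun p hp x => ?_⟩
  choose r hr hx using fun i => h p hp (x i)
  refine ⟨∏ i, r i, fun h => ?_, fun i _ => ?_⟩
  · have := p.isPrime
    rw [Ideal.IsPrime.prod_mem_iff] at h
    obtain ⟨i, _, hi⟩ := h
    exact hr i hi
  · rw [Pi.smul_apply, ← Finset.prod_erase_mul _ _ (Finset.mem_univ i), mul_smul]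
    exact N.smul_mem _ (hx i)

/-- elements killed by an ideal -/
def ann (a : Ideal R) (A : Type u) [AddCommGroup A] [Module R A] : Submodule R A where
  carrier := {x | ∀ r ∈ a, r • x = 0}
  zero_mem' := by simp
  add_mem' := fun {x y} hx hy r hr => by rw [smul_add, hx r hr, hy r hr, add_zero]
  smul_mem' := fun c x hx r hr => by rw [smul_comm, hx r hr, smul_zero]

lemma mem_ann_span {F : Finset R} {x : A} (h : ∀ r ∈ F, r • x = 0) :
    x ∈ ann (Ideal.span (F : Set R)) A := by
  intro r hr
  induction hr using Submodule.span_induction with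
  | mem r hr => exact h r hr
  | zero => simp
  | add x y _ _ hx hy => rw [add_smul, hx, hy, add_zero]
  | smul c x _ hx => rw [smul_assoc, hx, smul_zero]

lemma Sc_gens [IsNoetherianRing R] (a : Ideal R) (K : Submodule R A) (hK : Sc W K) (hB : Sc W B)
    (g : a → A →ₗ[R] B)
    (hg : ∀ F : Finset a, Ideal.span ((fun r : a => (r : R)) '' F) = a →
      ∀ x, (∀ r ∈ F, g r x = 0) → x ∈ K) :
    Sc W A := by
  classical
  obtain ⟨F0, hF0⟩ := IsNoetherian.noetherian a
  have hsub : ∀ r ∈ F0, r ∈ a := fun r hr => hF0 ▸ Submodule.subset_span hr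
  let F : Finset a := F0.attach.image (fun r => ⟨r.1, hsub r.1 r.2⟩)
  have hF : Ideal.span ((fun r : a => (r : R)) '' F) = a := by
    have : ((fun r : a => (r : R)) '' F) = F0 := by
      ext r
      constructor
      · rintro ⟨r, hr, rfl⟩
        obtain ⟨s, _, rfl⟩ := Finset.mem_image.1 hr
        exact s.2
      · intro hr
        exact ⟨⟨r, hsub r hr⟩, Finset.mem_image.2 ⟨⟨r, hr⟩, Finset.mem_attach _ _, rfl⟩, rfl⟩
    rw [this]
    exact hF0
  let e := F.equivFin
  let φ : A →ₗ[R] (Fin F.card → B) := LinearMap.pi (fun i => g (e.symm i))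
  have hle : LinearMap.ker φ ≤ K := by
    intro x hx
    refine hg F hF x (fun r hr => ?_)
    have := congrFun (LinearMap.mem_ker.1 hx) (e ⟨r, hr⟩)
    simpa [φ] using this
  have h1 : Sc W (LinearMap.ker φ) :=
    Sc_inj (Submodule.inclusion hle) (Submodule.inclusion_injective hle) hK
  refine Sc_ext (f := (LinearMap.ker φ).subtype) (g := φ) ?_ h1 (Sc_pi hB)
  exact LinearMap.exact_subtype_ker_map φ

lemma mem_ann_of_gens {a : Ideal R} {F : Finset a}
    (hF : Ideal.span ((fun r : a => (r : R)) '' F) = a) {x : A}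
    (h : ∀ r ∈ F, (r : R) • x = 0) : x ∈ ann a A := by
  classical
  have h2 := mem_ann_span (F := F.image (fun r : a => (r : R))) (x := x) (by
    intro r hr
    obtain ⟨s, hs, rfl⟩ := Finset.mem_image.1 hr
    exact h s hs)
  rw [Finset.coe_image, hF] at h2
  exact h2

lemma Sc_ker [IsNoetherianRing R] (a : Ideal R) (f : B →ₗ[R] C) (h1 : Sc W (LinearMap.ker f))
    (h2 : Sc W (ann a B)) : Sc W (ann a C ⊓ LinearMap.range f : Submodule R C) := by
  let B' := (ann a C).comap f
  have hB' : Sc W B' := by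
    refine Sc_gens a ((ann a B).comap B'.subtype) ?_ h1
      (fun r => LinearMap.codRestrict (LinearMap.ker f) ((r : R) • B'.subtype) ?_) ?_
    · exact Sc_inj (B'.subtype.restrict (p := (ann a B).comap B'.subtype) (q := ann a B)
        (fun _ hx => hx))
        (fun x y hxy => Subtype.ext (Subtype.ext (congrArg (fun z : ann a B => (z : B)) hxy))) h2
    · intro x
      rw [LinearMap.mem_ker, LinearMap.smul_apply, map_smul]
      exact x.2 r r.2
    · intro F hF x hx
      exact mem_ann_of_gens hF (fun r hr => congrArg Subtype.val (hx r hr))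
  refine Sc_surj (LinearMap.codRestrict _ (f.comp B'.subtype) ?_) ?_ hB'
  · intro x
    exact ⟨x.2, ⟨x, rfl⟩⟩
  · rintro ⟨_, hc, ⟨x, rfl⟩⟩
    exact ⟨⟨x, hc⟩, rfl⟩

lemma Sc_ann_pow [IsNoetherianRing R] (a : Ideal R) (h : Sc W (ann a A)) (t : ℕ) :
    Sc W (ann (a ^ t) A) := by
  induction t with
  | zero =>
    refine Sc_of_Sm fun p _ x => ⟨1, one_notMem_prime p, Subtype.ext ?_⟩
    exact x.2 1 (by simp)
  | succ t ih =>
    refine Sc_gens a ((ann a A).comap (ann (a ^ (t+1)) A).subtype) ?_ ih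
      (fun r => LinearMap.codRestrict _ ((r : R) • (ann (a ^ (t+1)) A).subtype) ?_) ?_
    · exact Sc_inj ((ann (a ^ (t+1)) A).subtype.restrict
        (p := (ann a A).comap (ann (a ^ (t+1)) A).subtype) (q := ann a A) (fun _ hx => hx))
        (fun x y hxy => Subtype.ext (Subtype.ext (congrArg (fun z : ann a A => (z : A)) hxy))) h
    · intro x s hs
      rw [LinearMap.smul_apply, smul_smul]
      exact x.2 _ (by rw [pow_succ]; exact Ideal.mul_mem_mul hs r.2)
    · intro F hF x hx
      exact mem_ann_of_gens hF (fun r hr => congrArg Subtype.val (hx r hr))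

/-- Lemma K2 -/
lemma Sc_of_pow_small [IsNoetherianRing R] (a : Ideal R) (h : Sc W (ann a A)) (t : ℕ)
    (ht : Sm W (a ^ t • (⊤ : Submodule R A) : Submodule R A)) : Sc W A := by
  refine Sc_gens (a ^ t) (ann (a ^ t) A) (Sc_ann_pow a h t) (Sc_of_Sm ht)
    (fun r => LinearMap.codRestrict _ ((r : R) • LinearMap.id) ?_) ?_
  · intro x
    exact Submodule.smul_mem_smul r.2 trivial
  · intro F hF x hx
    exact mem_ann_of_gens hF (fun r hr => congrArg Subtype.val (hx r hr))

end Serre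

end LCaux

namespace LCaux
section LemmaK
variable {R : Type u} [CommRing R] [IsNoetherianRing R] (a : Ideal R)

lemma tors_quot_eq_bot (M : Type u) [AddCommGroup M] [Module R M] [Module.Finite R M]
    (m : M ⧸ tors a M) (hm : m ∈ tors a (M ⧸ tors a M)) : m = 0 := by
  obtain ⟨y, rfl⟩ := Submodule.Quotient.mk_surjective _ m
  obtain ⟨t, ht⟩ := hm
  rw [Submodule.Quotient.mk_eq_zero]
  have hN : IsNoetherian R M := isNoetherian_of_isNoetherianRing_of_finite R M
  obtain ⟨s, hs⟩ := fg_tors a (tors a M) (IsNoetherian.noetherian _) le_rfl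
  refine ⟨s + t, fun r hr => ?_⟩
  rw [pow_add] at hr
  refine Submodule.mul_induction_on hr (fun u hu v hv => ?_) (fun u v hu hv => ?_)
  · rw [mul_smul]
    refine hs u hu _ ?_
    have := ht v hv
    rwa [← Submodule.Quotient.mk_smul, Submodule.Quotient.mk_eq_zero] at this
  · rw [add_smul, hu, hv, add_zero]

lemma exists_regular (M : Type u) [AddCommGroup M] [Module R M] [Module.Finite R M]
    (h : ∀ m ∈ tors a M, m = 0) : ∃ x ∈ a, ∀ m : M, x • m = 0 → m = 0 := by
  classical
  by_contra hcon
  push Not at hcon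
  have hsub : (a : Set R) ⊆ ⋃ p ∈ ((associatedPrimes.finite R M).toFinset : Set (Ideal R)), (p : Set R) := by
    intro x hx
    obtain ⟨m, hm, hm0⟩ := hcon x hx
    have : x ∈ ⋃ p ∈ associatedPrimes R M, (p : Set R) := by
      rw [biUnion_associatedPrimes_eq_zero_divisors R M]
      exact ⟨m, hm0, hm⟩
    simpa using this
  obtain ⟨q, hq, hle⟩ := (Ideal.subset_union_prime (f := fun p : Ideal R => p) ⊥ ⊥ (by
    intro p hp _ _
    exact ((associatedPrimes.finite R M).mem_toFinset.1 hp).1)).1 hsub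
  rw [Set.Finite.mem_toFinset, AssociatedPrimes.mem_iff, isAssociatedPrime_iff] at hq
  obtain ⟨hp, m, rfl⟩ := hq
  have hm : m = 0 := h m ⟨1, fun r hr => by
    rw [pow_one] at hr
    simpa [Submodule.mem_colon_singleton] using hle hr⟩
  apply hp.ne_top
  subst hm
  rw [Ideal.eq_top_iff_one]
  simp [Submodule.mem_colon_singleton]

variable {W : Set (PrimeSpectrum R)}

theorem lemmaK (i : ℕ) : ∀ (M : Type u) [AddCommGroup M] [Module R M] [Module.Finite R M],
    (∀ j < i, Sc W (locH R a j M)) → Sc W (ann a (locH R a i M)) := by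
  induction i with
  | zero =>
    intro M _ _ _ _
    exact Sc_inj ((jj a M).comp (ann a (locH R a 0 M)).subtype)
      ((jj_inj a).comp Subtype.val_injective) Sc_of_finite
  | succ i ih =>
    intro M _ _ _ hM
    let π := (tors a M).mkQ
    have hi : Function.Injective (tors a M).subtype := Subtype.val_injective
    have hs : Function.Surjective π := Submodule.mkQ_surjective _
    have he : Function.Exact (tors a M).subtype π := LinearMap.exact_subtype_mkQ _
    have hv := fun j x => torsion_vanish a j (tors a M) (isTors_tors a) x
    have hinj : ∀ j, Function.Injective (Hm a (j+1) π) := by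
      intro j
      rw [injective_iff_map_eq_zero]
      intro x hx
      obtain ⟨y, rfl⟩ := (les₂ a hi hs he (j+1) x).1 hx
      rw [hv j y, map_zero]
    have hsurj : ∀ j, Function.Surjective (Hm a (j+1) π) := by
      intro j x
      obtain ⟨δ, h1, -⟩ := les a hi hs he (j+1)
      exact (h1 x).1 (hv _ _)
    let M' := M ⧸ tors a M
    have ht : ∀ m ∈ tors a M', m = 0 := tors_quot_eq_bot a M
    have hM' : ∀ j < i + 1, Sc W (locH R a j M') := by
      intro j hj
      cases j with
      | zero =>
        refine Sc_of_Sm fun p _ x => ⟨1, one_notMem_prime p, ?_⟩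
        rw [one_smul]
        apply jj_inj a
        rw [map_zero]
        exact ht _ ((jj_range a (A := M')).le ⟨x, rfl⟩)
      | succ j => exact Sc_surj _ (hsurj j) (hM _ hj)
    suffices hS : Sc W (ann a (locH R a (i+1) M')) by
      refine Sc_inj (LinearMap.restrict (p := ann a (locH R a (i+1) M))
        (q := ann a (locH R a (i+1) M')) (Hm a (i+1) π) (fun x hx r hr => ?_)) ?_ hS
      · rw [← map_smul, hx r hr, map_zero]
      · intro x y hxy
        exact Subtype.ext (hinj i (congrArg Subtype.val hxy))
    obtain ⟨x, hxa, hx⟩ := exists_regular a M' ht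
    let f : M' →ₗ[R] M' := x • LinearMap.id
    have hf : Function.Injective f := (injective_iff_map_eq_zero f).2 hx
    let Q := M' ⧸ LinearMap.range f
    let g : M' →ₗ[R] Q := (LinearMap.range f).mkQ
    have hg : Function.Surjective g := (les_quot hf).1
    have hfg : Function.Exact f g := (les_quot hf).2
    have hQ : ∀ j < i, Sc W (locH R a j Q) := by
      intro j hj
      obtain ⟨δ, h1, -⟩ := les a hf hg hfg j
      exact Sc_ext h1 (hM' j (by lia)) (hM' (j+1) (by lia))
    have hK := ih Q hQ
    obtain ⟨δ, h1, h2⟩ := les a hf hg hfg i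
    have hker : Sc W (LinearMap.ker δ) := by
      refine Sc_surj (LinearMap.codRestrict _ (Hm a i g) ?_) ?_ (hM' i (by lia))
      · exact fun y => (h1 _).2 ⟨y, rfl⟩
      · rintro ⟨y, hy⟩
        obtain ⟨z, rfl⟩ := (h1 y).1 hy
        exact ⟨z, rfl⟩
    have hfin := Sc_ker a δ hker hK
    have hle : ann a (locH R a (i+1) M') ≤ ann a (locH R a (i+1) M') ⊓ LinearMap.range δ := by
      intro y hy
      refine ⟨hy, (h2 y).1 ?_⟩
      exact (Hm_smul a (i+1) x y).trans (hy x hxa)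
    exact Sc_inj (Submodule.inclusion hle) (Submodule.inclusion_injective hle) hfin

end LemmaK
end LCaux

namespace LCaux
section Main
variable {R : Type u} [CommRing R]

/-- primes of coheight at least `n` -/
def Wn (R : Type u) [CommRing R] (n : ℕ) : Set (PrimeSpectrum R) :=
  {p | (n : WithBot ℕ∞) ≤ ringKrullDim (R ⧸ p.asIdeal)}

lemma Wn_le {n : ℕ} {p q : PrimeSpectrum R} (h : q ≤ p) (hp : p ∈ Wn R n) : q ∈ Wn R n :=
  le_trans hp (ringKrullDim_le_of_surjective (Ideal.Quotient.factor (S := q.asIdeal) (T := p.asIdeal) h)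
    (Ideal.Quotient.factor_surjective h))

lemma le_dimSupp_iff (n : ℕ) (X : Type u) [AddCommGroup X] [Module R X] :
    (n : WithBot ℕ∞) ≤ dimSupp R X ↔ ¬ Sm (Wn R n) X := by
  have hup : ∀ p q : PrimeSpectrum R, p ≤ q → p ∈ Module.support R X → q ∈ Module.support R X := by
    intro p q h hp
    rw [Module.mem_support_iff'] at hp ⊢
    obtain ⟨m, hm⟩ := hp
    exact ⟨m, fun r hr => hm r (fun h' => hr (h h'))⟩
  constructor
  · intro h hS
    obtain ⟨l, hl⟩ := Order.le_krullDim_iff.1 h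
    have hW : (l.head : PrimeSpectrum R) ∈ Wn R n := by
      change (n : WithBot ℕ∞) ≤ ringKrullDim (R ⧸ (l.head : PrimeSpectrum R).asIdeal)
      rw [ringKrullDim_quotient, Order.le_krullDim_iff]
      refine ⟨⟨l.length, fun k => ⟨(l k : PrimeSpectrum R), ?_⟩, fun k => l.step k⟩, hl⟩
      exact l.head_le k
    obtain ⟨m, hm⟩ := (Module.mem_support_iff').1 l.head.2
    obtain ⟨r, hr, h0⟩ := hS _ hW m
    exact hm r hr h0
  · intro h
    unfold Sm at h
    push Not at h
    obtain ⟨p, hp, x, hx⟩ := h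
    have hps : p ∈ Module.support R X := Module.mem_support_iff'.2 ⟨x, hx⟩
    refine le_trans hp ?_
    rw [ringKrullDim_quotient]
    exact Order.krullDim_le_of_strictMono
      (fun q : PrimeSpectrum.zeroLocus (p.asIdeal : Set R) =>
        (⟨q.1, hup p q.1 q.2 hps⟩ : Module.support R X)) (fun _ _ h => h)

variable [IsNoetherianRing R] (a : Ideal R)
  (M : Type u) [AddCommGroup M] [Module R M] [Module.Finite R M] (n : ℕ)

lemma finite_loc_of_Sc {W : Set (PrimeSpectrum R)} (X : Type u) [AddCommGroup X] [Module R X]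
    (h : Sc W X) (p : PrimeSpectrum R) (hp : p ∈ W) :
    Module.Finite (Localization p.asIdeal.primeCompl) (LocalizedModule p.asIdeal.primeCompl X) := by
  obtain ⟨N, hN, h⟩ := h
  have : Module.Finite R N := Module.Finite.iff_fg.2 hN
  have : Module.Finite (Localization p.asIdeal.primeCompl)
      (LocalizedModule p.asIdeal.primeCompl N) :=
    Module.Finite.of_isLocalizedModule p.asIdeal.primeCompl
      (LocalizedModule.mkLinearMap p.asIdeal.primeCompl N)
  refine Module.Finite.of_surjective (mp p.asIdeal.primeCompl N.subtype) ?_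
  intro x
  induction x using LocalizedModule.induction_on with
  | h x s =>
  obtain ⟨r, hr, hx⟩ := h p hp x
  refine ⟨LocalizedModule.mk ⟨r • x, hx⟩ (⟨r, hr⟩ * s), ?_⟩
  rw [mp_mk]
  exact LocalizedModule.mk_cancel_common_left ⟨r, hr⟩ s x

lemma partA : fabn R a a M n ≤ fan R a M n := by
  refine le_sInf ?_
  rintro _ ⟨p, -, hp, rfl⟩
  refine le_sInf ?_
  rintro _ ⟨i, hi, rfl⟩
  by_contra hlt
  rw [not_le] at hlt
  apply hi
  have hsm : ∀ j ≤ i, ∃ t : ℕ,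
      Sm (Wn R n) (a ^ t • (⊤ : Submodule R (locH R a j M)) : Submodule R (locH R a j M)) := by
    intro j hj
    by_contra hcon
    push Not at hcon
    have : fabn R a a M n ≤ (j : ℕ∞) :=
      sInf_le ⟨j, fun t => (le_dimSupp_iff n _).2 (hcon t), rfl⟩
    exact absurd (lt_of_lt_of_le hlt this) (not_lt.2 (by exact_mod_cast hj))
  have hsc : ∀ j ≤ i, Sc (Wn R n) (locH R a j M) := by
    intro j
    induction j using Nat.strong_induction_on with
    | h j ih =>
      intro hj
      obtain ⟨t, ht⟩ := hsm j hj
      exact Sc_of_pow_small a (lemmaK a j M (fun k hk => ih k hk (by lia))) t ht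
  obtain ⟨e⟩ := loc_iso a p.asIdeal.primeCompl i M
  have := finite_loc_of_Sc _ (hsc i le_rfl) p hp
  exact Module.Finite.equiv e

/-- the annihilator of an element of an associated prime -/
lemma exists_assoc_le {X : Type u} [AddCommGroup X] [Module R X] (p : PrimeSpectrum R) (y : X)
    (hy : ∀ r ∉ p.asIdeal, r • y ≠ 0) :
    ∃ q : PrimeSpectrum R, q ≤ p ∧ ∃ c : R, ∀ r, r ∈ q.asIdeal ↔ r • c • y = 0 := by
  have hle : Module.annihilator R (Submodule.span R {y}) ≤ p.asIdeal := by
    intro r hr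
    by_contra hrp
    exact hy r hrp (congrArg Subtype.val
      (Module.mem_annihilator.1 hr ⟨y, Submodule.mem_span_singleton_self y⟩))
  have := p.isPrime
  obtain ⟨q, hq, hqp⟩ := Ideal.exists_minimalPrimes_le hle
  have hass := Module.associatedPrimes.minimalPrimes_annihilator_subset_associatedPrimes R
    (Submodule.span R {y}) hq
  rw [AssociatedPrimes.mem_iff, isAssociatedPrime_iff] at hass
  obtain ⟨hqP, ⟨z, hz⟩, rfl⟩ := hass
  obtain ⟨c, rfl⟩ := Submodule.mem_span_singleton.1 hz
  refine ⟨⟨_, hqP⟩, hqp, c, fun r => ?_⟩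
  rw [Submodule.mem_colon_singleton, Submodule.mem_bot, Subtype.ext_iff]
  rfl

/-- finitely many relevant associated primes -/
lemma finite_assoc {W : Set (PrimeSpectrum R)} {X : Type u} [AddCommGroup X] [Module R X]
    (hX : Sc W (ann a X)) (hT : IsTors a X) :
    {q : PrimeSpectrum R | q ∈ W ∧ ∃ x : X, ∀ r, r ∈ q.asIdeal ↔ r • x = 0}.Finite := by
  obtain ⟨N, hN, h⟩ := hX
  have : Module.Finite R N := Module.Finite.iff_fg.2 hN
  refine Set.Finite.of_finite_image (f := PrimeSpectrum.asIdeal)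
    ((associatedPrimes.finite R N).subset ?_) (fun _ _ _ _ h => PrimeSpectrum.ext h)
  rintro _ ⟨q, ⟨hq, x, hx⟩, rfl⟩
  obtain ⟨t, ht⟩ := hT x
  have ha : a ≤ q.asIdeal := q.isPrime.le_of_pow_le (n := t) (fun r hr => (hx r).2 (ht r hr))
  obtain ⟨r, hr, hrN⟩ := h q hq ⟨x, fun s hs => (hx s).1 (ha hs)⟩
  rw [AssociatedPrimes.mem_iff, isAssociatedPrime_iff]
  refine ⟨q.isPrime, ⟨_, hrN⟩, ?_⟩
  ext s
  rw [Submodule.mem_colon_singleton, Submodule.mem_bot, Subtype.ext_iff, Subtype.ext_iff]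
  change s ∈ q.asIdeal ↔ s • r • x = 0
  rw [← mul_smul, ← hx]
  exact ⟨fun h => q.asIdeal.mul_mem_right r h, fun h => (q.isPrime.mem_or_mem h).resolve_right hr⟩

lemma mk_zero_iff (X : Type u) [AddCommGroup X] [Module R X] (q : PrimeSpectrum R) (x : X)
    (h : (LocalizedModule.mk x 1 : LocalizedModule q.asIdeal.primeCompl X) = 0) :
    ∃ u ∉ q.asIdeal, u • x = 0 := by
  rw [← LocalizedModule.zero_mk 1, LocalizedModule.mk_eq] at h
  obtain ⟨u, hu⟩ := h
  rw [one_smul, smul_zero, smul_zero] at hu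
  exact ⟨u, u.2, hu⟩

/-- a finitely generated torsion localization is killed by a power -/
lemma loc_kill (X : Type u) [AddCommGroup X] [Module R X] (hT : IsTors a X) (q : PrimeSpectrum R)
    [Module.Finite (Localization q.asIdeal.primeCompl)
      (LocalizedModule q.asIdeal.primeCompl X)] :
    ∃ t : ℕ, ∀ y ∈ a ^ t • (⊤ : Submodule R X), ∃ u ∉ q.asIdeal, u • y = 0 := by
  obtain ⟨t, ht⟩ := fg_tors (a.map (algebraMap R (Localization q.asIdeal.primeCompl)))
    (⊤ : Submodule _ (LocalizedModule q.asIdeal.primeCompl X)) Module.Finite.fg_top (by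
      intro x _
      rw [mem_tors_loc]
      induction x using LocalizedModule.induction_on with
      | h x s => exact ⟨x, s, hT x, rfl⟩)
  refine ⟨t, fun y hy => ?_⟩
  refine Submodule.smul_induction_on hy (fun r hr x _ => ?_) ?_
  · have h1 := ht (algebraMap R _ r) (by rw [← Ideal.map_pow]; exact Ideal.mem_map_of_mem _ hr)
      (LocalizedModule.mk x 1) trivial
    rw [algebraMap_smul, LocalizedModule.smul'_mk] at h1
    exact mk_zero_iff X q _ h1
  · rintro x y ⟨u, hu, hux⟩ ⟨v, hv, hvy⟩
    refine ⟨u * v, fun h => (q.isPrime.mem_or_mem h).elim hu hv, ?_⟩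
    rw [smul_add, mul_smul u v y, hvy, mul_comm u v, mul_smul v u x, hux, smul_zero, smul_zero,
      add_zero]

lemma partB : fan R a M n ≤ fabn R a a M n := by
  classical
  refine le_sInf ?_
  rintro _ ⟨i, hi, rfl⟩
  by_contra hlt
  rw [not_le] at hlt
  have hfin : ∀ j ≤ i, ∀ p ∈ Module.support R (M ⧸ (a • ⊤ : Submodule R M)), p ∈ Wn R n →
      Module.Finite (Localization p.asIdeal.primeCompl)
        (LocalizedModule p.asIdeal.primeCompl (locH R a j M)) := by
    intro j hj p hp hpW
    by_contra hcon
    obtain ⟨e⟩ := loc_iso a p.asIdeal.primeCompl j M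
    have h1 : finDim (Localization.AtPrime p.asIdeal)
      (a.map (algebraMap R (Localization.AtPrime p.asIdeal)))
      (LocalizedModule p.asIdeal.primeCompl M) ≤ (j : ℕ∞) :=
      sInf_le ⟨j, fun h => hcon (@Module.Finite.equiv _ _ _ _ _ _ _ _ h e.symm), rfl⟩
    have h2 : fan R a M n ≤ _ := sInf_le ⟨p, hp, hpW, rfl⟩
    exact absurd (lt_of_lt_of_le hlt (h2.trans h1)) (not_lt.2 (by exact_mod_cast hj))
  have key : ∀ j ≤ i, Sc (Wn R n) (locH R a j M) ∧ ∃ t : ℕ,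
      Sm (Wn R n) (a ^ t • (⊤ : Submodule R (locH R a j M)) : Submodule R (locH R a j M)) := by
    intro j
    induction j using Nat.strong_induction_on with
    | h j ih =>
    intro hj
    have hK := lemmaK a j M (fun k hk => (ih k hk (by lia)).1)
    have hT := H_isTors a j M
    have hF := finite_assoc a hK hT
    have hex : ∀ q ∈ {q : PrimeSpectrum R | q ∈ Wn R n ∧
        ∃ x : locH R a j M, ∀ r, r ∈ q.asIdeal ↔ r • x = 0},
        ∃ t : ℕ, ∀ y ∈ a ^ t • (⊤ : Submodule R (locH R a j M)), ∃ u ∉ q.asIdeal, u • y = 0 := by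
      rintro q ⟨hq, x, hx⟩
      have hsupp : q ∈ Module.support R (M ⧸ (a • ⊤ : Submodule R M)) := by
        rw [Module.support_quotient]
        refine ⟨?_, ?_⟩
        · by_contra hcon
          rw [Module.notMem_support_iff] at hcon
          obtain ⟨e⟩ := loc_iso a q.asIdeal.primeCompl j M
          have hz : (LocalizedModule.mk x 1 : LocalizedModule q.asIdeal.primeCompl _) = 0 :=
            e.injective (by rw [map_zero]; exact H_subsingleton _ _ _)
          obtain ⟨u, hu, hux⟩ := mk_zero_iff _ q x hz
          exact hu ((hx u).2 hux)
        · obtain ⟨t, ht⟩ := hT x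
          exact q.isPrime.le_of_pow_le (n := t) (fun r hr => (hx r).2 (ht r hr))
      have := hfin j hj q hsupp hq
      exact loc_kill a _ hT q
    choose! t ht using hex
    have hsm : Sm (Wn R n) (a ^ (hF.toFinset.sup t) • (⊤ : Submodule R (locH R a j M)) :
        Submodule R (locH R a j M)) := by
      by_contra hcon
      unfold Sm at hcon
      push Not at hcon
      obtain ⟨p, hp, y, hy⟩ := hcon
      obtain ⟨q, hqp, c, hc⟩ := exists_assoc_le p y hy
      have hc' : ∀ r, r ∈ q.asIdeal ↔ r • ((c • y : _) : locH R a j M) = 0 := by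
        intro r
        rw [hc, Subtype.ext_iff]
        rfl
      have hq : q ∈ Wn R n ∧ ∃ x : locH R a j M, ∀ r, r ∈ q.asIdeal ↔ r • x = 0 :=
        ⟨Wn_le hqp hp, _, hc'⟩
      have hle : t q ≤ hF.toFinset.sup t := Finset.le_sup (hF.mem_toFinset.2 hq)
      obtain ⟨u, hu, huy⟩ := ht q hq _ (Submodule.smul_mono (Ideal.pow_le_pow_right hle) le_rfl
        (Subtype.mem (c • y)))
      exact hu ((hc' u).2 huy)
    exact ⟨Sc_of_pow_small a hK _ hsm, _, hsm⟩
  obtain ⟨-, t, ht⟩ := key i le_rfl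
  exact (le_dimSupp_iff n _).1 (hi t) ht

end Main
end LCaux

end LCauxAll

/-- over a complete local ring, `f_a^n(M) = f_a^a(M)_n`. -/
theorem fan_eq_faan (R : Type u) [CommRing R] [IsNoetherianRing R]
    [IsLocalRing R] [IsAdicComplete (IsLocalRing.maximalIdeal R) R]
    (a : Ideal R)
    (M : Type u) [AddCommGroup M] [Module R M] [Module.Finite R M] (n : ℕ) :
    fan R a M n = fabn R a a M n := by
  exact le_antisymm (LCaux.partB a M n) (LCaux.partA a M n)
end

section
/- Let R be a commutative Noetherian ring, M a finitely generated R-module, and b ⊆ a ideals of R. For any non-negative integers i and s, the following are equivalent: (i) there exists an integer n such that dim Supp(b^n H^i_a(M)) < s; (ii) there exists an integer m such that b^m H^i_a(M) is in dimension < s. -/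
open CategoryTheory

universe u

lemma homologyMap_smul_aux (R : Type u) [CommRing R] (K : CochainComplex (ModuleCat.{u} R) ℕ)
    (r : R) (i : ℕ) :
    HomologicalComplex.homologyMap (r • 𝟙 K) i = r • 𝟙 (K.homology i) := by
  rw [← HomologicalComplex.homologyMap_id]
  exact ShortComplex.homologyMap_smul (φ := (HomologicalComplex.shortComplexFunctor _ _ i).map (𝟙 K)) (a := r)

noncomputable def homAux (R : Type u) [CommRing R] (P : ChainComplex (ModuleCat.{u} R) ℕ)
    (Y : ModuleCat.{u} R) (h : ∀ i j, P.X i ⟶ P.X j) (i j : ℕ) :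
    (P.linearYonedaObj R Y).X i ⟶ (P.linearYonedaObj R Y).X j :=
  ModuleCat.ofHom (Linear.leftComp R Y (h j i))

noncomputable def homotopyAux (R : Type u) [CommRing R] (P : ChainComplex (ModuleCat.{u} R) ℕ)
    (Y : ModuleCat.{u} R) (r : R) (h : Homotopy (r • 𝟙 P) 0) :
    Homotopy (r • 𝟙 (P.linearYonedaObj R Y)) 0 where
  hom := homAux R P Y h.hom
  zero i j hij := by
    have : h.hom j i = 0 := h.zero j i hij
    unfold homAux
    rw [this]
    ext f : 2
    exact Limits.zero_comp (C := ModuleCat R) (f := f)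
  comm n := by
    have hc := h.comm n
    rw [HomologicalComplex.zero_f, add_zero] at hc ⊢
    rw [Homotopy.dNext_cochainComplex]
    cases n with
    | zero =>
      rw [Homotopy.prevD_zero_cochainComplex]
      rw [Homotopy.dNext_zero_chainComplex, Homotopy.prevD_chainComplex] at hc
      ext (f : P.X 0 ⟶ Y) : 2
      have := congrArg (· ≫ f) hc
      simp only [HomologicalComplex.smul_f_apply, HomologicalComplex.id_f, Linear.smul_comp,
        Category.id_comp, zero_add, Category.assoc] at this
      simp only [add_zero]
      exact this
    | succ n =>
      rw [Homotopy.prevD_succ_cochainComplex]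
      rw [Homotopy.dNext_succ_chainComplex, Homotopy.prevD_chainComplex] at hc
      ext (f : P.X (n+1) ⟶ Y) : 2
      have := congrArg (· ≫ f) hc
      simp only [HomologicalComplex.smul_f_apply, HomologicalComplex.id_f, Linear.smul_comp,
        Category.id_comp, Preadditive.add_comp, Category.assoc] at this

      exact this.trans (add_comm _ _)

lemma ext_smul_eq_zero (R : Type u) [CommRing R] (i : ℕ) (X Y : ModuleCat.{u} R) (r : R)
    (hr : ∀ x : X, r • x = 0) (z : ((Ext R (ModuleCat.{u} R) i).obj (Opposite.op X)).obj Y) :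
    r • z = 0 := by
  let P := projectiveResolution X
  have h0 : (r • 𝟙 P.complex) ≫ P.π = 0 := by
    rw [Linear.smul_comp, Category.id_comp]
    ext x
    simp only [HomologicalComplex.smul_f_apply, ModuleCat.hom_smul, LinearMap.smul_apply]
    exact hr _
  have h1 := (homotopyAux R P.complex Y r
    (ProjectiveResolution.liftHomotopyZero (r • 𝟙 P.complex) h0)).homologyMap_eq i
  rw [homologyMap_smul_aux, HomologicalComplex.homologyMap_zero] at h1
  let e := (P.isoExt (R := R) i Y).toLinearEquiv
  apply e.injective
  rw [map_smul, map_zero]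
  exact congrArg (fun g => g.hom (e z)) h1

def torsSub (R : Type u) [CommRing R] (a : Ideal R) (M : Type u) [AddCommGroup M] [Module R M] :
    Submodule R M where
  carrier := {z | ∃ k : ℕ, ∀ r ∈ a ^ k, r • z = 0}
  zero_mem' := ⟨0, fun r _ => smul_zero r⟩
  add_mem' := by
    rintro x y ⟨k, hk⟩ ⟨l, hl⟩
    refine ⟨max k l, fun r hr => ?_⟩
    rw [smul_add, hk r (Ideal.pow_le_pow_right (le_max_left _ _) hr),
      hl r (Ideal.pow_le_pow_right (le_max_right _ _) hr), add_zero]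
  smul_mem' := by
    rintro c x ⟨k, hk⟩
    exact ⟨k, fun r hr => by rw [smul_comm, hk r hr, smul_zero]⟩

lemma locH_torsion (R : Type u) [CommRing R] (a : Ideal R) (i : ℕ) (M : ModuleCat.{u} R)
    (z : (localCohomology a i).obj M) : ∃ k : ℕ, ∀ r ∈ a ^ k, r • z = 0 := by
  let D := localCohomology.diagram (localCohomology.idealPowersDiagram a) i
  have : Limits.HasColimit D := localCohomology.hasColimitDiagram.{u, 0} _ i
  have hc : Limits.IsColimit (((evaluation _ _).obj M).mapCocone (Limits.colimit.cocone D)) :=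
    Limits.isColimitOfPreserves _ (Limits.colimit.isColimit D)
  let T := torsSub R a ((localCohomology a i).obj M)
  have key : ModuleCat.ofHom T.mkQ = 0 := by
    refine hc.hom_ext fun j => ?_
    ext y
    refine (Submodule.Quotient.mk_eq_zero T).2 ⟨j.unop.unop, fun r hr => ?_⟩
    have h : r • y = 0 := by
      refine ext_smul_eq_zero R i _ M r ?_ y
      intro x
      obtain ⟨x, rfl⟩ := Ideal.Quotient.mk_surjective x
      exact Ideal.Quotient.eq_zero_iff_mem.2 (Ideal.mul_mem_right x _ hr)
    have := congrArg (((evaluation _ _).obj M).mapCocone (Limits.colimit.cocone D) |>.ι.app j).hom h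
    rw [map_smul, map_zero] at this
    exact this
  have : T.mkQ z = 0 := congrArg (fun g => g.hom z) key
  exact (Submodule.Quotient.mk_eq_zero T).1 this

lemma main_aux (R : Type u) [CommRing R] (b : Ideal R) (H : Type u) [AddCommGroup H] [Module R H]
    (ht : ∀ z : H, ∃ k : ℕ, ∀ r ∈ b ^ k, r • z = 0) (m : ℕ)
    (N : Submodule R ↥(b ^ m • (⊤ : Submodule R H))) (hN : N.FG) :
    ∃ n, Module.support R ↥(b ^ n • (⊤ : Submodule R H)) ⊆
      Module.support R (↥(b ^ m • (⊤ : Submodule R H)) ⧸ N) := by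
  obtain ⟨S, rfl⟩ := hN
  choose k hk using ht
  have hS : ∀ x ∈ Submodule.span R (S : Set ↥(b ^ m • (⊤ : Submodule R H))),
      ∀ r ∈ b ^ (S.sup fun x => k x.1), r • x = 0 := by
    intro x hx r hr
    induction hx using Submodule.span_induction with
    | mem x hx =>
      apply Subtype.ext
      exact hk _ r (Ideal.pow_le_pow_right (Finset.le_sup (f := fun x => k x.1) hx) hr)
    | zero => simp
    | add x y _ _ hx hy => rw [smul_add, hx, hy, add_zero]
    | smul c x _ hx => rw [smul_comm, hx, smul_zero]
  set N := Submodule.span R (S : Set ↥(b ^ m • (⊤ : Submodule R H)))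
  set l := S.sup fun x => k x.1
  refine ⟨l + m, fun p hp => ?_⟩
  by_contra hq
  rw [Module.notMem_support_iff'] at hq
  refine Module.notMem_support_iff'.2 ?_ hp
  rintro ⟨x, hx⟩
  suffices ∃ t ∉ p.asIdeal, t • x = 0 by
    obtain ⟨t, ht, h⟩ := this
    exact ⟨t, ht, Subtype.ext h⟩
  rw [pow_add, mul_smul] at hx
  induction hx using Submodule.smul_induction_on' with
  | smul r hr y hy =>
    obtain ⟨t, ht, h⟩ := hq (Submodule.Quotient.mk ⟨y, hy⟩)
    rw [← Submodule.Quotient.mk_smul, Submodule.Quotient.mk_eq_zero] at h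
    refine ⟨t, ht, ?_⟩
    rw [smul_comm]
    exact congrArg Subtype.val (hS _ h r hr)
  | add x _ y _ hx hy =>
    obtain ⟨t, ht, h⟩ := hx
    obtain ⟨t', ht', h'⟩ := hy
    refine ⟨t * t', p.2.mul_notMem ht ht', ?_⟩
    rw [smul_add, mul_smul t t' y, h', mul_comm, mul_smul, h]; simp

/-- `∃ n, dim Supp (b^n H^i_a(M)) < s` iff
`∃ m, b^m H^i_a(M)` is in dimension `< s`. -/
theorem exists_dim_lt_iff_exists_inDimLT (R : Type u) [CommRing R] [IsNoetherianRing R]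
    (a b : Ideal R) (hba : b ≤ a)
    (M : Type u) [AddCommGroup M] [Module R M] [Module.Finite R M] (i s : ℕ) :
    (∃ n : ℕ,
      dimSupp R ↥(b ^ n • (⊤ : Submodule R (locH R a i M))) < (s : WithBot ℕ∞)) ↔
    (∃ m : ℕ, InDimLT R s ↥(b ^ m • (⊤ : Submodule R (locH R a i M)))) := by
  constructor
  · rintro ⟨n, hn⟩
    refine ⟨n, ⊥, Submodule.fg_bot, ?_⟩
    unfold dimSupp at hn ⊢
    rwa [(Submodule.quotEquivOfEqBot (⊥ : Submodule R
      ↥(b ^ n • (⊤ : Submodule R (locH R a i M)))) rfl).support_eq]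
  · rintro ⟨m, N, hN, hd⟩
    obtain ⟨n, hn⟩ := main_aux R b (locH R a i M) (fun z => by
      obtain ⟨k, hk⟩ := locH_torsion R a i (ModuleCat.of R M) z
      exact ⟨k, fun r hr => hk r (Ideal.pow_right_mono hba k hr)⟩) m N hN
    refine ⟨n, lt_of_le_of_lt ?_ hd⟩
    exact Order.krullDim_le_of_strictMono (Set.inclusion hn) (fun _ _ h => h)
end

section
/- Let R be a commutative Noetherian ring, M a finitely generated R-module, and b ⊆ a ideals of R. For any non-negative integer n, f_a^b(M)_n = inf{i ≥ 0 : b^m H^i_a(M) is not in dimension < n for all m}. -/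
open CategoryTheory

universe u

section helpers

open CategoryTheory Limits Opposite

/-- The opposite of a linear category is linear. -/
@[reducible] noncomputable def opLinear (R : Type*) [CommRing R] (C : Type*) [Category C]
    [Preadditive C] [Linear R C] : Linear R Cᵒᵖ where
  homModule X Y :=
    { smul := fun r f => (r • f.unop).op
      one_smul := fun f => Quiver.Hom.unop_inj (one_smul R f.unop)
      mul_smul := fun r s f => Quiver.Hom.unop_inj (mul_smul r s f.unop)
      smul_zero := fun r => Quiver.Hom.unop_inj (smul_zero r)
      smul_add := fun r f g => Quiver.Hom.unop_inj (smul_add r f.unop g.unop)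
      add_smul := fun r s f => Quiver.Hom.unop_inj (add_smul r s f.unop)
      zero_smul := fun f => Quiver.Hom.unop_inj (zero_smul R f.unop) }
  smul_comp X Y Z r f g := Quiver.Hom.unop_inj (Linear.comp_smul _ _ _ g.unop r f.unop)
  comp_smul X Y Z f r g := Quiver.Hom.unop_inj (Linear.smul_comp _ _ _ r g.unop f.unop)

lemma leftDerived_map_smul_id {R : Type*} [CommRing R] {C D : Type*} [Category C] [Category D]
    [Abelian C] [HasProjectiveResolutions C] [Abelian D] [Linear R C] [Linear R D]
    (F : C ⥤ D) [F.Additive] [F.Linear R] (n : ℕ) (X : C) (r : R) :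
    (F.leftDerived n).map (r • 𝟙 X) = r • 𝟙 _ := by
  let P := projectiveResolution X
  rw [F.leftDerived_map_eq n (r • 𝟙 X) (P := P) (Q := P) (r • 𝟙 _) ?_]
  · have h : (F.mapHomologicalComplex (ComplexShape.down ℕ) ⋙
        HomologicalComplex.homologyFunctor _ _ n).map (r • 𝟙 P.complex) = r • 𝟙 _ := by
      rw [Functor.comp_map, Functor.map_smul, CategoryTheory.Functor.map_id]
      change ShortComplex.homologyMap _ = _
      have : (HomologicalComplex.shortComplexFunctor D (ComplexShape.down ℕ) n).map
          (r • 𝟙 ((F.mapHomologicalComplex (ComplexShape.down ℕ)).obj P.complex))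
          = r • 𝟙 _ := by
        ext <;> simp <;> rfl
      erw [this, ShortComplex.homologyMap_smul, ShortComplex.homologyMap_id]
      rfl
    rw [h]
    simp
  · ext
    simp
    exact ((Linear.comp_smul _ _ _ _ r (𝟙 X)).trans (congrArg (r • ·) (Category.comp_id _))).symm

lemma ext_smul_zero {R : Type u} [CommRing R] (n : ℕ) (X Y : ModuleCat.{u} R) (r : R)
    (hr : ∀ x : X, r • x = 0) (z : ((Ext R (ModuleCat.{u} R) n).obj (op X)).obj Y) :
    r • z = 0 := by
  letI := opLinear R (ModuleCat.{u} R)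
  haveI : (((linearYoneda R (ModuleCat.{u} R)).obj Y).rightOp).Linear R :=
    { map_smul := fun f s => by
        apply Quiver.Hom.unop_inj
        ext g
        exact Linear.smul_comp _ _ _ s f g }
  have h := leftDerived_map_smul_id (R := R)
    (((linearYoneda R (ModuleCat.{u} R)).obj Y).rightOp) n X r
  have h0 : r • 𝟙 X = (0 : R) • 𝟙 X := by
    rw [zero_smul]
    ext x
    exact hr x
  have h' := leftDerived_map_smul_id (R := R)
    (((linearYoneda R (ModuleCat.{u} R)).obj Y).rightOp) n X 0
  rw [h0] at h
  replace h := h'.symm.trans h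
  rw [zero_smul] at h
  have h2 := congrArg Quiver.Hom.unop h
  have h3 := congrArg (fun f => (ModuleCat.Hom.hom f) z) h2
  exact h3.symm

/-- elements killed by a power of `a`. -/
def torsPow {R : Type*} [CommRing R] (a : Ideal R) (H : Type*) [AddCommGroup H] [Module R H] :
    Submodule R H where
  carrier := {x | ∃ k : ℕ, ∀ r ∈ a ^ k, r • x = 0}
  zero_mem' := ⟨0, by simp⟩
  add_mem' := by
    rintro x y ⟨k, hk⟩ ⟨l, hl⟩
    refine ⟨k + l, fun r hr => ?_⟩
    rw [smul_add, hk r (Ideal.pow_le_pow_right (Nat.le_add_right k l) hr),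
      hl r (Ideal.pow_le_pow_right (Nat.le_add_left l k) hr), add_zero]
  smul_mem' := by
    rintro c x ⟨k, hk⟩
    refine ⟨k, fun r hr => ?_⟩
    rw [smul_comm, hk r hr, smul_zero]

lemma locH_tors (R : Type u) [CommRing R] (a : Ideal R) (i : ℕ)
    (M : Type u) [AddCommGroup M] [Module R M] (x : locH R a i M) :
    x ∈ torsPow a (locH R a i M) := by
  haveI := localCohomology.hasColimitDiagram.{u, 0} (localCohomology.idealPowersDiagram a) i
  let D := localCohomology.diagram (localCohomology.idealPowersDiagram a) i
  let E := (evaluation (ModuleCat.{u} R) (ModuleCat.{u} R)).obj (ModuleCat.of R M)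
  have hc : IsColimit (E.mapCocone (colimit.cocone D)) :=
    isColimitOfPreserves E (colimit.isColimit D)
  let q : locH R a i M ⟶ ModuleCat.of R (locH R a i M ⧸ torsPow a (locH R a i M)) :=
    ModuleCat.ofHom (Submodule.mkQ _)
  have hq : q = 0 := by
    refine hc.hom_ext fun j => ?_
    ext z
    refine (Submodule.Quotient.mk_eq_zero _).2 ⟨j.unop.unop, fun r hr => ?_⟩
    have hz : r • z = 0 := ext_smul_zero i _ (ModuleCat.of R M) r (fun y => by
      obtain ⟨y, rfl⟩ := Ideal.Quotient.mk_surjective y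
      refine Ideal.Quotient.eq_zero_iff_mem.2 ?_
      exact Ideal.mul_mem_right _ _ hr) z
    have := congrArg ((E.mapCocone (colimit.cocone D)).ι.app j).hom hz
    rw [map_smul, map_zero] at this
    exact this
  have := congrArg (fun f => (ModuleCat.Hom.hom f) x) hq
  exact (Submodule.Quotient.mk_eq_zero _).1 this

lemma fg_killed {R : Type*} [CommRing R] (a : Ideal R) {H : Type*} [AddCommGroup H] [Module R H]
    (h : ∀ x : H, x ∈ torsPow a H) (N : Submodule R H) (hN : N.FG) :
    ∃ k : ℕ, ∀ r ∈ a ^ k, ∀ x ∈ N, r • x = 0 := by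
  induction N, hN using Submodule.fg_induction with
  | singleton x =>
    obtain ⟨k, hk⟩ := h x
    refine ⟨k, fun r hr y hy => ?_⟩
    obtain ⟨c, rfl⟩ := Submodule.mem_span_singleton.1 hy
    rw [smul_comm, hk r hr, smul_zero]
  | sup N₁ N₂ _ _ h₁ h₂ =>
    obtain ⟨k, hk⟩ := h₁
    obtain ⟨l, hl⟩ := h₂
    refine ⟨k + l, fun r hr y hy => ?_⟩
    obtain ⟨y, hy', z, hz, rfl⟩ := Submodule.mem_sup.1 hy
    rw [smul_add, hk r (Ideal.pow_le_pow_right (Nat.le_add_right k l) hr) _ hy',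
      hl r (Ideal.pow_le_pow_right (Nat.le_add_left l k) hr) _ hz, add_zero]

lemma dimSupp_mono {R : Type u} [CommRing R] {A B : Type u} [AddCommGroup A] [Module R A]
    [AddCommGroup B] [Module R B] (h : Module.support R A ⊆ Module.support R B) :
    dimSupp R A ≤ dimSupp R B :=
  Order.krullDim_le_of_strictMono (Set.inclusion h) (fun _ _ hxy => hxy)

lemma exists_dim_lt_iff {R : Type u} [CommRing R] (a b : Ideal R) (hba : b ≤ a) (n : ℕ)
    (H : Type u) [AddCommGroup H] [Module R H] (h : ∀ x : H, x ∈ torsPow a H) :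
    (∃ t : ℕ, dimSupp R ↥(b ^ t • (⊤ : Submodule R H)) < (n : WithBot ℕ∞)) ↔
      ∃ m : ℕ, InDimLT R n ↥(b ^ m • (⊤ : Submodule R H)) := by
  constructor
  · rintro ⟨t, ht⟩
    refine ⟨t, ⊥, Submodule.fg_bot, lt_of_le_of_lt (dimSupp_mono ?_) ht⟩
    exact Module.support_subset_of_surjective (Submodule.mkQ _) (Submodule.mkQ_surjective _)
  · rintro ⟨m, N, hN, hd⟩
    obtain ⟨k, hk⟩ := fg_killed a h (N.map (Submodule.subtype _)) (hN.map _)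
    refine ⟨k + m, lt_of_le_of_lt (dimSupp_mono ?_) hd⟩
    intro p hp
    by_contra hcon
    refine Module.notMem_support_iff'.2 ?_ hp
    rw [Module.notMem_support_iff'] at hcon
    have key : ∀ x ∈ b ^ k • (b ^ m • (⊤ : Submodule R H)),
        ∃ s ∉ p.asIdeal, s • x = 0 := by
      intro x hx
      induction hx using Submodule.smul_induction_on' with
      | smul r hr y hy =>
        obtain ⟨s, hs, hsy⟩ := hcon (Submodule.Quotient.mk ⟨y, hy⟩)
        refine ⟨s, hs, ?_⟩
        rw [← Submodule.Quotient.mk_smul, Submodule.Quotient.mk_eq_zero] at hsy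
        rw [smul_comm]
        exact hk r (Ideal.pow_right_mono hba k hr) _ ⟨_, hsy, rfl⟩
      | add x hx y hy h₁ h₂ =>
        obtain ⟨s, hs, hsx⟩ := h₁
        obtain ⟨t, ht, hty⟩ := h₂
        refine ⟨s * t, fun hst => (p.isPrime.mem_or_mem hst).elim hs ht, ?_⟩
        rw [smul_add, mul_smul, mul_smul, hty, smul_comm, hsx, smul_zero, smul_zero, add_zero]
    rintro ⟨x, hx⟩
    rw [pow_add, Submodule.mul_smul] at hx
    obtain ⟨s, hs, hsx⟩ := key x hx
    exact ⟨s, hs, Subtype.ext hsx⟩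

end helpers

/-- `f_a^b(M)_n = inf{i : b^m H^i_a(M) is not in dimension < n for all m}`. -/
theorem fabn_eq_inf_not_inDimLT (R : Type u) [CommRing R] [IsNoetherianRing R]
    (a b : Ideal R) (hba : b ≤ a)
    (M : Type u) [AddCommGroup M] [Module R M] [Module.Finite R M] (n : ℕ) :
    fabn R a b M n = sInf ((↑) '' {i : ℕ |
      ∀ m : ℕ, ¬ InDimLT R n ↥(b ^ m • (⊤ : Submodule R (locH R a i M)))}) := by
  unfold fabn
  congr 2
  ext i
  have h := exists_dim_lt_iff a b hba n (locH R a i M) (locH_tors R a i M)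
  rw [← not_iff_not] at h
  simpa only [not_exists, not_lt, Set.mem_ofPred_eq] using h
end

section
/- Let R be a commutative Noetherian ring, a an ideal, r a non-negative integer, and M a finitely generated R-module such that H^i_a(M) is finitely generated for all i < r and a^n H^r_a(M) = 0 for some n ∈ ℕ. Then H^r_a(M) is finitely generated. (Consequently f_a(M) = f_a^a(M).) -/
open CategoryTheory

universe u

namespace LCF
open Limits

section comparison
variable {R : Type u} [CommRing R]

/-- cocycles -/
def Zc {X : ModuleCat.{u} R} (P : ProjectiveResolution X) (Y : ModuleCat.{u} R) (n : ℕ) :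
    Submodule R (P.complex.X n ⟶ Y) where
  carrier := {f | P.complex.d (n+1) n ≫ f = 0}
  add_mem' := by
    intro f g hf hg
    simp only [Set.mem_ofPred_eq] at *
    rw [Preadditive.comp_add, hf, hg, add_zero]
  zero_mem' := by simp
  smul_mem' := by
    intro c f hf
    simp only [Set.mem_ofPred_eq] at *
    rw [Linear.comp_smul, hf, smul_zero]

lemma mem_Zc {X : ModuleCat.{u} R} {P : ProjectiveResolution X} {Y : ModuleCat.{u} R} {n : ℕ}
    {f : P.complex.X n ⟶ Y} : f ∈ Zc P Y n ↔ P.complex.d (n+1) n ≫ f = 0 := Iff.rfl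

noncomputable def zNew {X : ModuleCat.{u} R} (P : ProjectiveResolution X) (Y : ModuleCat.{u} R)
    (n : ℕ) : Zc P Y n →ₗ[R] Abelian.Ext X Y n where
  toFun f := P.extMk f.1 (n+1) rfl (mem_Zc.1 f.2)
  map_add' f g := by rw [P.add_extMk]; rfl
  map_smul' r f := by
    rw [RingHom.id_apply, Abelian.Ext.smul_eq_comp_mk₀, P.extMk_comp_mk₀]
    simp

lemma zNew_apply {X : ModuleCat.{u} R} (P : ProjectiveResolution X) (Y : ModuleCat.{u} R)
    (n : ℕ) (f : Zc P Y n) : zNew P Y n f = P.extMk f.1 (n+1) rfl (mem_Zc.1 f.2) := rfl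

lemma zNew_surj {X : ModuleCat.{u} R} (P : ProjectiveResolution X) (Y : ModuleCat.{u} R)
    (n : ℕ) : Function.Surjective (zNew P Y n) := by
  intro α
  obtain ⟨f, hf, h⟩ := P.extMk_surjective α (n+1) rfl
  exact ⟨⟨f, mem_Zc.2 hf⟩, h⟩

lemma zNew_eq_zero {X : ModuleCat.{u} R} (P : ProjectiveResolution X) (Y : ModuleCat.{u} R)
    (n : ℕ) (f : Zc P Y (n+1)) : zNew P Y (n+1) f = 0 ↔ 
      ∃ g : P.complex.X n ⟶ Y, P.complex.d (n+1) n ≫ g = f.1 := by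
  rw [zNew_apply, P.extMk_eq_zero_iff _ _ _ _ n rfl]

open CochainComplex HomComplex in
lemma zNew_eq_zero' {X : ModuleCat.{u} R} (P : ProjectiveResolution X) (Y : ModuleCat.{u} R)
    (f : Zc P Y 0) : zNew P Y 0 f = 0 ↔ f = 0 := by
  constructor
  · intro h
    rw [zNew_apply, ← P.extEquivCohomologyClass.apply_eq_iff_eq,
      ProjectiveResolution.extEquivCohomologyClass_extMk, ProjectiveResolution.extEquivCohomologyClass_zero,
      CohomologyClass.mk_eq_zero_iff, Cocycle.toSingleMk_mem_coboundaries_iff _ _ _ _ _ 1 (by simp)] at h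
    obtain ⟨g, hg⟩ := h
    have : P.cochainComplex.d (-((0:ℕ):ℤ)) 1 = 0 := by
      apply IsZero.eq_of_tgt
      apply CochainComplex.isZero_of_isStrictlyLE _ 0 1 (by simp)
    rw [this, zero_comp] at hg
    ext1
    rw [← cancel_epi (P.cochainComplexXIso (-(0:ℕ)) 0 rfl).hom]
    simpa using hg.symm
  · rintro rfl; simp

/-- pullback of cocycles along a map of resolutions -/
def Zmap {X X' : ModuleCat.{u} R} {P : ProjectiveResolution X} {P' : ProjectiveResolution X'}
    (Y : ModuleCat.{u} R) (n : ℕ) {g : X' ⟶ X} (φ : ProjectiveResolution.Hom P' P g) (f : Zc P Y n) :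
    Zc P' Y n := ⟨φ.hom.f n ≫ f.1, by 
        rw [mem_Zc, ← φ.hom.comm_assoc, mem_Zc.1 f.2, comp_zero]⟩

lemma zNew_nat {X X' : ModuleCat.{u} R} (P : ProjectiveResolution X) (P' : ProjectiveResolution X')
    (Y : ModuleCat.{u} R) (n : ℕ) {g : X' ⟶ X} (φ : ProjectiveResolution.Hom P' P g) (f : Zc P Y n) :
    (Abelian.Ext.mk₀ g).comp (zNew P Y n f) (zero_add _) =
      zNew P' Y n (Zmap Y n φ f) := by
  rw [zNew_apply, ProjectiveResolution.mk₀_comp_extMk _ _ _ _ φ, zNew_apply]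
  rfl

noncomputable abbrev oE (n : ℕ) (X Y : ModuleCat.{u} R) : ModuleCat.{u} R :=
  ((Ext R (ModuleCat.{u} R) n).obj (Opposite.op X)).obj Y

noncomputable def zι {X : ModuleCat.{u} R} (P : ProjectiveResolution X) (Y : ModuleCat.{u} R)
    (n : ℕ) : ModuleCat.of R (Zc P Y n) ⟶ (P.complex.linearYonedaObj R Y).X n :=
  ModuleCat.ofHom (Zc P Y n).subtype

noncomputable def zL {X : ModuleCat.{u} R} (P : ProjectiveResolution X) (Y : ModuleCat.{u} R)
    (n : ℕ) : ModuleCat.of R (Zc P Y n) ⟶ (P.complex.linearYonedaObj R Y).cycles n :=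
  (P.complex.linearYonedaObj R Y).liftCycles (zι P Y n) (n+1) (by simp) (by
      ext f
      exact f.2)

lemma zL_i {X : ModuleCat.{u} R} (P : ProjectiveResolution X) (Y : ModuleCat.{u} R)
    (n : ℕ) (f : Zc P Y n) : (P.complex.linearYonedaObj R Y).iCycles n (zL P Y n f) = f.1 := by
  rw [← ModuleCat.comp_apply, zL, HomologicalComplex.liftCycles_i]
  rfl

noncomputable def zOld {X : ModuleCat.{u} R} (P : ProjectiveResolution X) (Y : ModuleCat.{u} R)
    (n : ℕ) : Zc P Y n →ₗ[R] oE n X Y :=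
  (zL P Y n ≫ (P.complex.linearYonedaObj R Y).homologyπ n ≫ (P.isoExt n Y).inv).hom

lemma zOld_apply {X : ModuleCat.{u} R} (P : ProjectiveResolution X) (Y : ModuleCat.{u} R)
    (n : ℕ) (f) : zOld P Y n f = 
  (P.isoExt n Y).inv ((P.complex.linearYonedaObj R Y).homologyπ n (zL P Y n f)) := rfl

lemma zOld_surj {X : ModuleCat.{u} R} (P : ProjectiveResolution X) (Y : ModuleCat.{u} R)
    (n : ℕ) : Function.Surjective (zOld P Y n) := by
  intro y
  obtain ⟨y, rfl⟩ := ((ModuleCat.epi_iff_surjective (P.isoExt n Y).inv).1 inferInstance) y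
  obtain ⟨y, rfl⟩ := ((ModuleCat.epi_iff_surjective 
    ((P.complex.linearYonedaObj R Y).homologyπ n)).1 inferInstance) y
  refine ⟨⟨(P.complex.linearYonedaObj R Y).iCycles n y, ?_⟩, ?_⟩
  · change ((P.complex.linearYonedaObj R Y).iCycles n ≫ (P.complex.linearYonedaObj R Y).d n (n+1)) y = 0
    rw [(P.complex.linearYonedaObj R Y).iCycles_d]; rfl
  · rw [zOld_apply]
    congr 2
    apply (ModuleCat.mono_iff_injective ((P.complex.linearYonedaObj R Y).iCycles n)).1 inferInstance
    rw [zL_i]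

lemma hπ_zero (K : CochainComplex (ModuleCat.{u} R) ℕ) (n p : ℕ) 
    (hp : (ComplexShape.up ℕ).prev n = p)
    (z : K.cycles n) : K.homologyπ n z = 0 ↔ ∃ g, K.d p n g = K.iCycles n z := by
  have h1 : (ShortComplex.mk _ _ (K.toCycles_comp_homologyπ p n)).Exact :=
      ShortComplex.exact_of_g_is_cokernel _ (K.homologyIsCokernel p n hp)
  have h2 : K.homologyπ n z = 0 ↔ ∃ g, K.toCycles p n g = z := by
    constructor
    · intro h; exact (ShortComplex.moduleCat_exact_iff _).1 h1 z h
    · rintro ⟨g, rfl⟩; rw [← ModuleCat.comp_apply, K.toCycles_comp_homologyπ]; rfl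
  rw [h2]
  refine exists_congr fun g => ?_
  rw [← ((ModuleCat.mono_iff_injective (K.iCycles n)).1 inferInstance).eq_iff, ← ModuleCat.comp_apply,
    K.toCycles_i]

lemma zOld_eq_zero_aux {X : ModuleCat.{u} R} (P : ProjectiveResolution X) (Y : ModuleCat.{u} R)
    (n p : ℕ) (hp : (ComplexShape.up ℕ).prev n = p) (f : Zc P Y n) : zOld P Y n f = 0 ↔ 
      ∃ g : (P.complex.linearYonedaObj R Y).X p, (P.complex.linearYonedaObj R Y).d p n g = f.1 := by
  have h2 : zOld P Y n f = 0 ↔ (P.complex.linearYonedaObj R Y).homologyπ n (zL P Y n f) = 0 :=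
    (P.isoExt n Y).toLinearEquiv.symm.map_eq_zero_iff
  rw [h2, hπ_zero _ n p hp]
  refine exists_congr fun g => ?_
  rw [zL_i]

lemma zOld_eq_zero_iff {X : ModuleCat.{u} R} (P : ProjectiveResolution X) (Y : ModuleCat.{u} R)
    (n : ℕ) (f : Zc P Y n) : zOld P Y n f = 0 ↔ zNew P Y n f = 0 := by
  cases n with
  | zero =>
    rw [zOld_eq_zero_aux P Y 0 0 (by simp), zNew_eq_zero']
    constructor
    · rintro ⟨g, hg⟩
      rw [HomologicalComplex.shape _ _ _ (by simp)] at hg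
      ext1; exact hg.symm
    · rintro rfl
      exact ⟨0, map_zero _⟩
  | succ n =>
    rw [zOld_eq_zero_aux P Y (n+1) n (by simp), zNew_eq_zero]
    rfl

noncomputable def cmp {X : ModuleCat.{u} R} (P : ProjectiveResolution X) (Y : ModuleCat.{u} R)
    (n : ℕ) : Abelian.Ext X Y n ≃ₗ[R] oE n X Y :=
  ((zNew P Y n).quotKerEquivOfSurjective (zNew_surj P Y n)).symm ≪≫ₗ
   Submodule.quotEquivOfEq _ _ (by ext f; simp [zOld_eq_zero_iff]) ≪≫ₗ
   ((zOld P Y n).quotKerEquivOfSurjective (zOld_surj P Y n))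

lemma cmp_zNew {X : ModuleCat.{u} R} (P : ProjectiveResolution X) (Y : ModuleCat.{u} R)
    (n : ℕ) (f : Zc P Y n) : cmp P Y n (zNew P Y n f) = zOld P Y n f := by
  have : ((zNew P Y n).quotKerEquivOfSurjective (zNew_surj P Y n)).symm (zNew P Y n f) = 
    Submodule.Quotient.mk f := by
    rw [LinearEquiv.symm_apply_eq]; rfl
  simp [cmp, this]

noncomputable def φY {C C' : ChainComplex (ModuleCat.{u} R) ℕ} (φ : C' ⟶ C) (Y : ModuleCat.{u} R) :
    C.linearYonedaObj R Y ⟶ C'.linearYonedaObj R Y :=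
  (HomologicalComplex.unopFunctor _ _).map 
    (((((linearYoneda R (ModuleCat.{u} R)).obj Y).rightOp.mapHomologicalComplex _).map φ)).op

lemma homologyUnop_nat {K L : HomologicalComplex (ModuleCat.{u} R)ᵒᵖ (ComplexShape.down ℕ)}
    (φ : K ⟶ L) (n : ℕ) :
    (L.homologyUnop n).hom ≫ (HomologicalComplex.homologyMap φ n).unop = 
      HomologicalComplex.homologyMap ((HomologicalComplex.unopFunctor _ _).map φ.op) n ≫ 
        (K.homologyUnop n).hom := by
  have := HomologicalComplex.homologyOp_hom_naturality ((HomologicalComplex.unopFunctor _ _).map φ.op) n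
  apply Quiver.Hom.op_inj
  exact this

lemma abs_cat {C : Type*} [Category C] {A B D E F G : C} (u : A ⟶ B) (b : B ⟶ D) (b' : D ⟶ B)
    (m : B ⟶ E) (c : E ⟶ F) (v : A ⟶ G) (w : G ⟶ E) (h : b ≫ b' = 𝟙 B) (h2 : u ≫ m = v ≫ w) :
    (u ≫ b) ≫ b' ≫ m ≫ c = v ≫ w ≫ c := by
  rw [Category.assoc, reassoc_of% h, reassoc_of% h2]

lemma isoExt_nat {X X' : ModuleCat.{u} R} (P : ProjectiveResolution X) (P' : ProjectiveResolution X')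
    (Y : ModuleCat.{u} R) (n : ℕ) {g : X' ⟶ X} (φ : ProjectiveResolution.Hom P' P g) :
    (P.isoExt n Y).inv ≫ ((Ext R (ModuleCat.{u} R) n).map g.op).app Y =
      HomologicalComplex.homologyMap (φY φ.hom Y) n ≫ (P'.isoExt n Y).inv := by
  have h := Functor.leftDerived_map_eq ((linearYoneda R (ModuleCat.{u} R)).obj Y).rightOp n g
    φ.hom φ.hom_comp_π
  have h2 := homologyUnop_nat 
    (((((linearYoneda R (ModuleCat.{u} R)).obj Y).rightOp.mapHomologicalComplex _).map φ.hom)) n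
  have h3 : ((Ext R (ModuleCat.{u} R) n).map g.op).app Y = 
    ((((linearYoneda R (ModuleCat.{u} R)).obj Y).rightOp.leftDerived n).map g).unop := rfl
  have e1 : (P.isoExt (R := R) n Y).inv = (HomologicalComplex.homologyUnop _ n).hom ≫ 
    (P.isoLeftDerivedObj ((linearYoneda R (ModuleCat R)).obj Y).rightOp n).hom.unop := rfl
  have e2 : (P'.isoExt (R := R) n Y).inv = (HomologicalComplex.homologyUnop _ n).hom ≫ 
    (P'.isoLeftDerivedObj ((linearYoneda R (ModuleCat R)).obj Y).rightOp n).hom.unop := rfl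
  rw [h3, h, e1, e2]
  simp only [unop_comp, Category.assoc]
  exact abs_cat _ _ _ _ _ _ _ (congrArg Quiver.Hom.unop (Iso.inv_hom_id
    (P.isoLeftDerivedObj ((linearYoneda R (ModuleCat R)).obj Y).rightOp n))) h2

lemma cmp_nat {X X' : ModuleCat.{u} R} (P : ProjectiveResolution X) (P' : ProjectiveResolution X')
    (Y : ModuleCat.{u} R) (n : ℕ) (g : X' ⟶ X) (x : Abelian.Ext X Y n) :
    cmp P' Y n ((Abelian.Ext.mk₀ g).comp x (zero_add _)) = 
      ((Ext R (ModuleCat.{u} R) n).map g.op).app Y (cmp P Y n x) := by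
  obtain ⟨f, rfl⟩ := zNew_surj P Y n x
  obtain ⟨φ⟩ : Nonempty (ProjectiveResolution.Hom P' P g) :=
    ⟨⟨ProjectiveResolution.lift g P' P, ProjectiveResolution.lift_commutes_zero g P' P⟩⟩
  rw [zNew_nat P P' Y n φ, cmp_zNew, cmp_zNew, zOld_apply, zOld_apply, ← ModuleCat.comp_apply (P.isoExt n Y).inv,
    isoExt_nat P P' Y n φ, ModuleCat.comp_apply, ← ModuleCat.comp_apply _ (HomologicalComplex.homologyMap _ _),
    HomologicalComplex.homologyπ_naturality, ModuleCat.comp_apply]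
  congr 2
  apply (ModuleCat.mono_iff_injective ((P'.complex.linearYonedaObj R Y).iCycles n)).1 inferInstance
  rw [zL_i, ← ModuleCat.comp_apply, HomologicalComplex.cyclesMap_i, ModuleCat.comp_apply, zL_i]
  rfl
end comparison
end LCF

namespace LCF
open Limits

section colim
variable {R : Type u} [CommRing R]

/-- `R/a^t` -/
abbrev Q (a : Ideal R) (t : ℕ) : ModuleCat.{u} R := ModuleCat.of R (R ⧸ a ^ t)

def qm (a : Ideal R) (s t : ℕ) (h : s ≤ t) : Q a t ⟶ Q a s :=
  ModuleCat.ofHom (Submodule.mapQ _ _ LinearMap.id (Ideal.pow_le_pow_right h))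

lemma qm_comp (a : Ideal R) (s t v : ℕ) (h : s ≤ t) (h' : t ≤ v) :
    qm a t v h' ≫ qm a s t h = qm a s v (h.trans h') := by
  apply ModuleCat.hom_ext
  refine Submodule.linearMap_qext _ ?_
  ext
  rfl

lemma qm_id (a : Ideal R) (s : ℕ) : qm a s s le_rfl = 𝟙 _ := by
  apply ModuleCat.hom_ext
  refine Submodule.linearMap_qext _ ?_
  ext
  rfl

abbrev EE (a : Ideal R) (i : ℕ) (M : ModuleCat.{u} R) (t : ℕ) : Type u := Abelian.Ext (Q a t) M i

noncomputable def tr (a : Ideal R) (i : ℕ) (M : ModuleCat.{u} R) (s t : ℕ) (h : s ≤ t) :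
    EE a i M s →ₗ[R] EE a i M t :=
  (Abelian.Ext.mk₀ (qm a s t h)).precompOfLinear R M (zero_add i)

lemma tr_apply (a : Ideal R) (i : ℕ) (M : ModuleCat.{u} R) (s t : ℕ) (h : s ≤ t) (x : EE a i M s) :
    tr a i M s t h x = (Abelian.Ext.mk₀ (qm a s t h)).comp x (zero_add i) := rfl

instance (a : Ideal R) (i : ℕ) (M : ModuleCat.{u} R) :
    DirectedSystem (EE a i M) fun s t h => tr a i M s t h where
  map_self s x := by rw [tr_apply, qm_id, Abelian.Ext.mk₀_id_comp]
  map_map s t v h h' x := by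
    rw [tr_apply, tr_apply, tr_apply, Abelian.Ext.mk₀_comp_mk₀_assoc, qm_comp]

abbrev HH (a : Ideal R) (i : ℕ) (M : ModuleCat.{u} R) : Type u :=
  Module.DirectLimit (EE a i M) (tr a i M)

noncomputable abbrev ofH (a : Ideal R) (i : ℕ) (M : ModuleCat.{u} R) (t : ℕ) :
    EE a i M t →ₗ[R] HH a i M := Module.DirectLimit.of R ℕ (EE a i M) (tr a i M) t

noncomputable abbrev prs (X : ModuleCat.{u} R) : ProjectiveResolution X := projectiveResolution X

open localCohomology Opposite

noncomputable abbrev Fd (a : Ideal R) (i : ℕ) (M : ModuleCat.{u} R) : (ℕᵒᵖ)ᵒᵖ ⥤ ModuleCat.{u} R :=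
  diagram (idealPowersDiagram a) i ⋙ (evaluation _ _).obj M

noncomputable def ιO (a : Ideal R) (i : ℕ) (M : ModuleCat.{u} R) (t : ℕ) :
    oE i (Q a t) M →ₗ[R] (colimit (Fd a i M) : ModuleCat.{u} R) :=
  (colimit.ι (Fd a i M) (op (op t))).hom

noncomputable def ιF (a : Ideal R) (i : ℕ) (M : ModuleCat.{u} R) (t : ℕ) :
    EE a i M t →ₗ[R] (colimit (Fd a i M) : ModuleCat.{u} R) :=
  ιO a i M t ∘ₗ (cmp (prs (Q a t)) M i).toLinearMap

lemma ιF_tr (a : Ideal R) (i : ℕ) (M : ModuleCat.{u} R) (s t : ℕ) (h : s ≤ t) (x : EE a i M s) :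
    ιF a i M t (tr a i M s t h x) = ιF a i M s x := by
  have h1 := cmp_nat (prs (Q a s)) (prs (Q a t)) M i (qm a s t h) x
  rw [tr_apply]
  simp only [ιF, LinearMap.comp_apply, LinearEquiv.coe_coe]
  rw [h1]
  have h2 := colimit.w (Fd a i M) (homOfLE h).op.op
  exact DFunLike.congr_fun (congrArg ModuleCat.Hom.hom h2) (cmp (prs (Q a s)) M i x)

instance : PreservesColimitsOfShape ℕᵒᵖᵒᵖ (forget (ModuleCat.{u} R)) := by
  have : PreservesFilteredColimitsOfSize.{0,0} (forget (ModuleCat.{u} R)) := 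
    preservesFilteredColimitsOfSize_shrink _
  exact PreservesFilteredColimitsOfSize.preserves_filtered_colimits _

noncomputable def toF (a : Ideal R) (i : ℕ) (M : ModuleCat.{u} R) :
    HH a i M →ₗ[R] (colimit (Fd a i M) : ModuleCat.{u} R) :=
  Module.DirectLimit.lift R ℕ _ _ (ιF a i M) (ιF_tr a i M)

lemma toF_bij (a : Ideal R) (i : ℕ) (M : ModuleCat.{u} R) : Function.Bijective (toF a i M) := by
  constructor
  · rw [injective_iff_map_eq_zero]
    intro x hx
    obtain ⟨t, x, rfl⟩ := Module.DirectLimit.exists_of x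
    rw [toF, Module.DirectLimit.lift_of] at hx
    obtain ⟨j, f, hf⟩ := Concrete.colimit_rep_eq_zero R (Fd a i M) (op (op t)) _ hx
    obtain ⟨⟨v⟩⟩ := j
    have h : t ≤ v := leOfHom f.unop.unop
    have h1 := cmp_nat (prs (Q a t)) (prs (Q a v)) M i (qm a t v h) x
    have h2 : tr a i M t v h x = 0 := by
      apply (cmp (prs (Q a v)) M i).injective
      rw [tr_apply, h1, map_zero]
      exact hf
    rw [← Module.DirectLimit.of_f (hij := h), h2, map_zero]
  · intro y
    obtain ⟨⟨⟨t⟩⟩, y, rfl⟩ := Concrete.colimit_exists_rep (Fd a i M) y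
    refine ⟨ofH a i M t ((cmp (prs (Q a t)) M i).symm y), ?_⟩
    rw [toF, Module.DirectLimit.lift_of, ιF]
    exact congrArg (ιO a i M t) (LinearEquiv.apply_symm_apply (cmp (prs (Q a t)) M i) y)

noncomputable def locEquiv (a : Ideal R) (i : ℕ) (M : ModuleCat.{u} R) :
    HH a i M ≃ₗ[R] ((localCohomology a i).obj M : ModuleCat.{u} R) :=
  LinearEquiv.ofBijective (toF a i M) (toF_bij a i M) ≪≫ₗ
   (colimitObjIsoColimitCompEvaluation (diagram (idealPowersDiagram a) i) M).symm.toLinearEquiv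
end colim
end LCF

namespace LCF
open Limits

section les
variable {R : Type u} [CommRing R] (a : Ideal R)

noncomputable def postH {M N : ModuleCat.{u} R} {k : ℕ} (α : Abelian.Ext M N k) {i j : ℕ}
    (h : i + k = j) : HH a i M →ₗ[R] HH a j N :=
  Module.DirectLimit.map (fun t => α.postcompOfLinear R (Q a t) h) (by
    intro s t hst
    ext x
    simp only [LinearMap.comp_apply]
    change ((Abelian.Ext.mk₀ (qm a s t hst)).comp x (zero_add i)).comp α h =
      (Abelian.Ext.mk₀ (qm a s t hst)).comp (x.comp α h) (zero_add j)
    exact Abelian.Ext.comp_assoc _ _ _ _ _ (by omega))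

lemma postH_of {M N : ModuleCat.{u} R} {k : ℕ} (α : Abelian.Ext M N k) {i j : ℕ}
    (h : i + k = j) (t : ℕ) (x : EE a i M t) : postH a α h (ofH a i M t x) =
      ofH a j N t (x.comp α h) := by
  rw [postH, Module.DirectLimit.map_apply_of]
  rfl

lemma tr_comp {M N : ModuleCat.{u} R} {k : ℕ} (α : Abelian.Ext M N k) {i j : ℕ}
    (h : i + k = j) (s t : ℕ) (hst : s ≤ t) (x : EE a i M s) :
    tr a j N s t hst (x.comp α h) = (tr a i M s t hst x).comp α h :=
  (Abelian.Ext.comp_assoc _ _ _ (zero_add i) _ (by omega)).symm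

lemma postH_zero {M N : ModuleCat.{u} R} {k : ℕ} (α : Abelian.Ext M N k) {i j : ℕ}
    (h : i + k = j) (y : HH a i M) (hy : postH a α h y = 0) :
    ∃ t x, ofH a i M t x = y ∧ x.comp α h = 0 := by
  obtain ⟨t, x, rfl⟩ := Module.DirectLimit.exists_of y
  rw [postH_of] at hy
  obtain ⟨s, hs, hx⟩ := Module.DirectLimit.of.zero_exact hy
  refine ⟨s, tr a i M t s hs x, Module.DirectLimit.of_f, ?_⟩
  rw [← tr_comp, hx]

noncomputable abbrev mapH {M N : ModuleCat.{u} R} (f : M ⟶ N) (i : ℕ) : HH a i M →ₗ[R] HH a i N :=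
  postH a (Abelian.Ext.mk₀ f) (add_zero i)

noncomputable abbrev delH {S : ShortComplex (ModuleCat.{u} R)} (hS : S.ShortExact) (i : ℕ) : HH a i S.X₃ →ₗ[R] HH a (i+1) S.X₁ :=
  postH a hS.extClass rfl

lemma ex1 {S : ShortComplex (ModuleCat.{u} R)} (hS : S.ShortExact) (i : ℕ) (y : HH a (i+1) S.X₁) (hy : mapH a S.f (i+1) y = 0) :
    ∃ z, delH a hS i z = y := by
  obtain ⟨t, x, rfl, hx⟩ := postH_zero a _ _ y hy
  obtain ⟨w, hw⟩ := Abelian.Ext.covariant_sequence_exact₁ _ hS x hx rfl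
  exact ⟨ofH a i _ t w, by rw [delH, postH_of, hw]⟩

lemma ex2 {S : ShortComplex (ModuleCat.{u} R)} (hS : S.ShortExact) (i : ℕ) (y : HH a i S.X₂) (hy : mapH a S.g i y = 0) :
    ∃ z, mapH a S.f i z = y := by
  obtain ⟨t, x, rfl, hx⟩ := postH_zero a _ _ y hy
  obtain ⟨w, hw⟩ := Abelian.Ext.covariant_sequence_exact₂ _ hS x hx
  exact ⟨ofH a i _ t w, by rw [mapH, postH_of, hw]⟩

lemma ex3 {S : ShortComplex (ModuleCat.{u} R)} (hS : S.ShortExact) (i : ℕ) (y : HH a i S.X₃) (hy : delH a hS i y = 0) :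
    ∃ z, mapH a S.g i z = y := by
  obtain ⟨t, x, rfl, hx⟩ := postH_zero a _ _ y hy
  obtain ⟨w, hw⟩ := Abelian.Ext.covariant_sequence_exact₃ _ hS x rfl hx
  exact ⟨ofH a i _ t w, by rw [mapH, postH_of, hw]⟩

lemma mapH_smul {M : ModuleCat.{u} R} (c : R) (i : ℕ) (y : HH a i M) :
    mapH a (c • 𝟙 M) i y = c • y := by
  obtain ⟨t, x, rfl⟩ := Module.DirectLimit.exists_of y
  rw [mapH, postH_of, ← Abelian.Ext.smul_eq_comp_mk₀, map_smul]

lemma HH_tors {M : ModuleCat.{u} R} (i : ℕ) (y : HH a i M) : ∃ n : ℕ, ∀ c ∈ a ^ n, c • y = 0 := by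
  obtain ⟨t, x, rfl⟩ := Module.DirectLimit.exists_of y
  refine ⟨t, fun c hc => ?_⟩
  rw [← map_smul]
  have : c • x = 0 := by
    rw [← Abelian.Ext.mk₀_id_comp x, ← Abelian.Ext.smul_comp, ← Abelian.Ext.mk₀_smul]
    have : c • 𝟙 (Q a t) = 0 := by
      apply ModuleCat.hom_ext
      refine Submodule.linearMap_qext _ ?_
      ext
      change c • (Submodule.Quotient.mk (1 : R) : R ⧸ a ^ t) = 0
      rw [← Submodule.Quotient.mk_smul, Submodule.Quotient.mk_eq_zero]
      simpa using hc
    rw [this, Abelian.Ext.mk₀_zero, Abelian.Ext.zero_comp]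
  rw [this, map_zero]

/-- evaluation at `1` -/
noncomputable def ev (M : ModuleCat.{u} R) (t : ℕ) : EE a 0 M t →ₗ[R] M where
  toFun x := (Abelian.Ext.linearEquiv₀ (R := R) x).hom (Submodule.Quotient.mk 1)
  map_add' x y := by rw [map_add]; rfl
  map_smul' c x := by rw [map_smul]; rfl

lemma ev_inj (M : ModuleCat.{u} R) (t : ℕ) (x : EE a 0 M t) (hx : ev a M t x = 0) : x = 0 := by
  rw [← (Abelian.Ext.linearEquiv₀ (R := R)).map_eq_zero_iff]
  apply ModuleCat.hom_ext
  refine Submodule.linearMap_qext _ ?_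
  ext
  exact hx

lemma ev_mk₀ (M : ModuleCat.{u} R) (t : ℕ) (f : Q a t ⟶ M) :
    ev a M t (Abelian.Ext.mk₀ f) = f.hom (Submodule.Quotient.mk 1) := by
  rw [ev]
  change (Abelian.Ext.linearEquiv₀ (R := R) (Abelian.Ext.mk₀ f)).hom _ = _
  congr 2
  exact Equiv.apply_symm_apply Abelian.Ext.homEquiv₀ f

lemma ev_tr (M : ModuleCat.{u} R) (s t : ℕ) (h : s ≤ t) (x : EE a 0 M s) :
    ev a M t (tr a 0 M s t h x) = ev a M s x := by
  obtain ⟨f, rfl⟩ : ∃ f, Abelian.Ext.mk₀ f = x := ⟨_, Abelian.Ext.mk₀_homEquiv₀_apply x⟩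
  rw [tr_apply, Abelian.Ext.mk₀_comp_mk₀, ev_mk₀, ev_mk₀]
  rfl

noncomputable def evH (M : ModuleCat.{u} R) : HH a 0 M →ₗ[R] M :=
  Module.DirectLimit.lift R ℕ _ _ (ev a M) (ev_tr a M)

lemma evH_of (M : ModuleCat.{u} R) (t : ℕ) (x) : evH a M (ofH a 0 M t x) = ev a M t x :=
  Module.DirectLimit.lift_of ..

lemma evH_inj (M : ModuleCat.{u} R) : Function.Injective (evH a M) := by
  rw [injective_iff_map_eq_zero]
  intro y hy
  obtain ⟨t, x, rfl⟩ := Module.DirectLimit.exists_of y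
  rw [evH_of] at hy
  rw [ev_inj a M t x hy, map_zero]

lemma evH_surj (M : ModuleCat.{u} R) (m : M) (n : ℕ) (h : ∀ c ∈ a ^ n, c • m = 0) :
    ∃ y, evH a M y = m := by
  refine ⟨ofH a 0 M n (Abelian.Ext.mk₀ (ModuleCat.ofHom
    (Submodule.liftQ (a ^ n) (LinearMap.toSpanSingleton R M m) (fun c hc => h c hc)))), ?_⟩
  rw [evH_of, ev_mk₀]
  exact (Submodule.liftQ_apply _ _ _).trans (one_smul R m)

lemma evH_map {M N : ModuleCat.{u} R} (f : M ⟶ N) (y : HH a 0 M) :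
    evH a N (mapH a f 0 y) = f.hom (evH a M y) := by
  obtain ⟨t, x, rfl⟩ := Module.DirectLimit.exists_of y
  obtain ⟨g, rfl⟩ : ∃ f, Abelian.Ext.mk₀ f = x := ⟨_, Abelian.Ext.mk₀_homEquiv₀_apply x⟩
  rw [mapH, postH_of, evH_of, evH_of, Abelian.Ext.mk₀_comp_mk₀, ev_mk₀, ev_mk₀]
  rfl

lemma HH_inj {M : ModuleCat.{u} R} [Injective M] (i : ℕ) (y : HH a (i+1) M) : y = 0 := by
  obtain ⟨t, x, rfl⟩ := Module.DirectLimit.exists_of y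
  rw [Abelian.Ext.eq_zero_of_injective x, map_zero]

end les
end LCF

namespace LCF
open Limits

section tors
variable {R : Type u} [CommRing R] (a : Ideal R)

def Tors (T : Type u) [AddCommGroup T] [Module R T] : Prop :=
  ∀ x : T, ∃ n : ℕ, ∀ c ∈ a ^ n, c • x = 0

def Gam (M : Type u) [AddCommGroup M] [Module R M] : Submodule R M where
  carrier := {x | ∃ n : ℕ, ∀ c ∈ a ^ n, c • x = 0}
  add_mem' := by
    rintro x y ⟨n, hn⟩ ⟨m, hm⟩
    refine ⟨n + m, fun c hc => ?_⟩
    rw [smul_add, hn c (Ideal.pow_le_pow_right (by omega) hc),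
      hm c (Ideal.pow_le_pow_right (by omega) hc), add_zero]
  zero_mem' := ⟨0, by simp⟩
  smul_mem' := by
    rintro r x ⟨n, hn⟩
    exact ⟨n, fun c hc => by rw [smul_comm, hn c hc, smul_zero]⟩

variable {a} in
lemma mem_Gam {M : Type u} [AddCommGroup M] [Module R M] {x : M} :
    x ∈ Gam a M ↔ ∃ n : ℕ, ∀ c ∈ a ^ n, c • x = 0 := Iff.rfl

lemma tors_Gam (M : Type u) [AddCommGroup M] [Module R M] : Tors a (Gam a M) := by
  rintro ⟨x, n, hn⟩
  exact ⟨n, fun c hc => Subtype.ext (hn c hc)⟩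

variable {a} in
lemma Tors.bound {T : Type u} [AddCommGroup T] [Module R T] (h : Tors a T) (N : Submodule R T)
    (hN : N.FG) : ∃ n : ℕ, ∀ c ∈ a ^ n, ∀ x ∈ N, c • x = 0 := by
  induction N, hN using Submodule.fg_induction with
  | singleton x =>
    obtain ⟨n, hn⟩ := h x
    refine ⟨n, fun c hc y hy => ?_⟩
    obtain ⟨r, rfl⟩ := Submodule.mem_span_singleton.1 hy
    rw [smul_comm, hn c hc, smul_zero]
  | sup N₁ N₂ _ _ h1 h2 =>
    obtain ⟨n, hn⟩ := h1
    obtain ⟨m, hm⟩ := h2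
    refine ⟨n + m, fun c hc y hy => ?_⟩
    obtain ⟨y, hy', z, hz, rfl⟩ := Submodule.mem_sup.1 hy
    rw [smul_add, hn c (Ideal.pow_le_pow_right (by omega) hc) _ hy',
      hm c (Ideal.pow_le_pow_right (by omega) hc) _ hz, add_zero]

lemma Gam_injective [IsNoetherianRing R] (E : Type u) [AddCommGroup E] [Module R E]
    [Module.Injective R E] : Module.Injective R (Gam a E) := by
  apply Module.Baer.injective
  intro J f
  obtain ⟨n, hn⟩ := (tors_Gam a E).bound (LinearMap.range f) 
    (by rw [LinearMap.range_eq_map]; exact (IsNoetherian.noetherian (⊤ : Submodule R J)).map f)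
  obtain ⟨k, hk⟩ := Ideal.exists_pow_inf_eq_pow_smul a (M := R) J
  have hk' := hk (n + k) (by omega)
  rw [Nat.add_sub_cancel] at hk'
  let π : J →ₗ[R] (R ⧸ a ^ (n + k)) := (Submodule.mkQ (a ^ (n+k))) ∘ₗ J.subtype
  have hker : LinearMap.ker π ≤ LinearMap.ker ((Gam a E).subtype ∘ₗ f) := by
    intro x hx
    have hx1 : (x : R) ∈ a ^ (n + k) := by
      rw [LinearMap.mem_ker] at hx
      exact (Submodule.Quotient.mk_eq_zero _).1 hx
    have hx2 : (x : R) ∈ a ^ n • J := by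
      have : (x : R) ∈ a ^ (n + k) • (⊤ : Submodule R R) ⊓ J := ⟨by simpa using hx1, x.2⟩
      rw [hk'] at this
      exact Submodule.smul_mono le_rfl inf_le_right this
    have hx3 : x ∈ a ^ n • (⊤ : Submodule R J) := by
      have : (x : R) ∈ Submodule.map J.subtype (a ^ n • ⊤) := by
        rw [Submodule.map_smul'']; simpa using hx2
      obtain ⟨y, hy, hyx⟩ := this
      rwa [← Subtype.ext hyx]
    rw [LinearMap.mem_ker, LinearMap.comp_apply]
    have : f x = 0 := by
      have h4 : f x ∈ Submodule.map f (a ^ n • ⊤) := ⟨x, hx3, rfl⟩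
      rw [Submodule.map_smul''] at h4
      refine Submodule.smul_induction_on h4 ?_ ?_
      · rintro c hc _ ⟨y, _, rfl⟩
        exact hn c hc _ ⟨y, rfl⟩
      · intro y z hy hz; rw [hy, hz, add_zero]
    rw [this]; rfl
  obtain ⟨g, hg⟩ := Module.Injective.out (R := R) (Q := E)
    ((LinearMap.ker π).liftQ π le_rfl)
    (LinearMap.ker_eq_bot.1 (Submodule.ker_liftQ_eq_bot' _ _ rfl))
    ((LinearMap.ker π).liftQ _ hker)
  refine ⟨LinearMap.codRestrict (Gam a E) (g ∘ₗ Submodule.mkQ (a ^ (n+k))) ?_, ?_⟩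
  · intro r
    refine ⟨n + k, fun c hc => ?_⟩
    rw [LinearMap.comp_apply, ← map_smul, ← map_smul]
    have : Submodule.mkQ (a ^ (n+k)) (c • r) = 0 := 
      (Submodule.Quotient.mk_eq_zero _).2 (Ideal.mul_mem_right _ _ hc)
    rw [this, map_zero]
  · intro x hx
    ext
    have := hg (Submodule.Quotient.mk ⟨x, hx⟩)
    rw [Submodule.liftQ_apply, Submodule.liftQ_apply] at this
    exact this

def sesQ {M : Type u} [AddCommGroup M] [Module R M] (N : Submodule R M) :
    ShortComplex (ModuleCat.{u} R) :=
  ShortComplex.mk (ModuleCat.ofHom N.subtype) (ModuleCat.ofHom N.mkQ) (by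
    ext x; exact (Submodule.Quotient.mk_eq_zero N).2 x.2)

lemma sesQ_exact {M : Type u} [AddCommGroup M] [Module R M] (N : Submodule R M) :
    (sesQ N).ShortExact := by
  apply ModuleCat.shortComplex_shortExact
  · intro x
    change N.mkQ x = 0 ↔ x ∈ Set.range N.subtype
    rw [Submodule.coe_subtype, Subtype.range_coe]
    exact Submodule.Quotient.mk_eq_zero N
  · exact N.injective_subtype
  · exact N.mkQ_surjective

lemma sesF {A B : Type u} [AddCommGroup A] [Module R A] [AddCommGroup B] [Module R B]
    (f : A →ₗ[R] B) (hf : Function.Injective f) :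
    ∃ w, (ShortComplex.mk (ModuleCat.ofHom f) (ModuleCat.ofHom (LinearMap.range f).mkQ) w).ShortExact := by
  refine ⟨?_, ?_⟩
  · ext x; exact (Submodule.Quotient.mk_eq_zero _).2 ⟨x, rfl⟩
  · apply ModuleCat.shortComplex_shortExact
    · intro x
      change (LinearMap.range f).mkQ x = 0 ↔ x ∈ Set.range f
      simp
    · exact hf
    · exact (LinearMap.range f).mkQ_surjective

lemma emb_tors [IsNoetherianRing R] (T : Type u) [AddCommGroup T] [Module R T] (hT : Tors a T) :
    ∃ (G : ModuleCat.{u} R) (_ : Injective G) (_ : Tors a G) (f : T →ₗ[R] G), Function.Injective f := by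
  let E := Injective.under (ModuleCat.of R T)
  let ι : T →ₗ[R] E := (Injective.ι (ModuleCat.of R T)).hom
  have hι : Function.Injective ι :=
    (ModuleCat.mono_iff_injective (Injective.ι (ModuleCat.of R T))).1 inferInstance
  have hE : Injective (ModuleCat.of R E) := inferInstanceAs (Injective E)
  have := Module.injective_module_of_injective_object R E
  have hG := Gam_injective a E
  refine ⟨ModuleCat.of R (Gam a E), Module.injective_object_of_injective_module _ _, tors_Gam a E,
    LinearMap.codRestrict (Gam a E) ι ?_, ?_⟩
  · intro x
    obtain ⟨n, hn⟩ := hT x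
    exact ⟨n, fun c hc => by rw [← map_smul, hn c hc, map_zero]⟩
  · intro x y h
    exact hι (congrArg Subtype.val h)

theorem HH_tors_zero [IsNoetherianRing R] (i : ℕ) :
    ∀ (T : Type u) [AddCommGroup T] [Module R T] (_ : Tors a T) (y : HH a (i+1) (ModuleCat.of R T)),
      y = 0 := by
  induction i with
  | zero =>
    intro T _ _ hT y
    obtain ⟨G, _, hG, f, hf⟩ := emb_tors a T hT
    obtain ⟨w, hS⟩ := sesF f hf
    obtain ⟨z, rfl⟩ := ex1 a hS 0 y (HH_inj a 0 _)
    obtain ⟨g, hg⟩ := (LinearMap.range f).mkQ_surjective (evH a _ z)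
    obtain ⟨n, hn⟩ := hG g
    obtain ⟨v, hv⟩ := evH_surj a G g n hn
    have hz : mapH a (ModuleCat.ofHom (LinearMap.range f).mkQ) 0 v = z := by
      apply evH_inj
      rw [evH_map, hv]
      exact hg
    rw [← hz]
    obtain ⟨t, x, rfl⟩ := Module.DirectLimit.exists_of v
    rw [mapH, postH_of, delH, postH_of]
    have h2 := hS.comp_extClass
    have h3 : (Abelian.Ext.comp x (Abelian.Ext.mk₀ (ModuleCat.ofHom (LinearMap.range f).mkQ)) (add_zero 0)).comp
      hS.extClass (zero_add 1) = 0 :=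
      (Abelian.Ext.comp_assoc_of_second_deg_zero _ _ _ _).trans
        ((congrArg (fun e => Abelian.Ext.comp x e (zero_add 1)) h2).trans (Abelian.Ext.comp_zero _ _ _ _ _))
    exact (congrArg (ofH a 1 _ t) h3).trans (map_zero _)
  | succ i ih =>
    intro T _ _ hT y
    obtain ⟨G, _, hG, f, hf⟩ := emb_tors a T hT
    obtain ⟨w, hS⟩ := sesF f hf
    obtain ⟨z, rfl⟩ := ex1 a hS (i+1) y (HH_inj a _ _)
    have : Tors a (G ⧸ LinearMap.range f) := by
      intro x
      obtain ⟨x, rfl⟩ := (LinearMap.range f).mkQ_surjective x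
      obtain ⟨n, hn⟩ := hG x
      exact ⟨n, fun c hc => by rw [← map_smul, hn c hc, map_zero]⟩
    have hz : z = 0 := ih _ this z
    rw [hz, map_zero]

end tors
end LCF

namespace LCF
open Limits

section main
variable {R : Type u} [CommRing R] (a : Ideal R)

lemma fin_mid [IsNoetherianRing R] {A B C : Type u} [AddCommGroup A] [AddCommGroup B] [AddCommGroup C]
    [Module R A] [Module R B] [Module R C] (f : A →ₗ[R] B) (g : B →ₗ[R] C)
    (h : ∀ b, g b = 0 → ∃ x, f x = b) (hA : Module.Finite R A) (hC : Module.Finite R C) :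
    Module.Finite R B := by
  refine ⟨Submodule.fg_of_fg_map_of_fg_inf_ker g (IsNoetherian.noetherian _) ?_⟩
  have h1 : (LinearMap.range f).FG := by
    rw [LinearMap.range_eq_map]; exact (IsNoetherian.noetherian (⊤ : Submodule R A)).map f
  have : IsNoetherian R (LinearMap.range f) := isNoetherian_of_fg_of_noetherian _ h1
  refine Submodule.FG.of_le h1 ?_
  rintro b ⟨_, hb⟩
  exact h b hb

def Kill (n : ℕ) (H : Type u) [AddCommGroup H] [Module R H] : Prop := ∀ c ∈ a ^ n, ∀ y : H, c • y = 0

variable {a} in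
lemma kill_iff (n : ℕ) (H : Type u) [AddCommGroup H] [Module R H] :
    a ^ n • (⊤ : Submodule R H) = ⊥ ↔ Kill a n H := by
  rw [Kill, eq_bot_iff, Submodule.smul_le]
  simp

lemma kill_of_fg (M : ModuleCat.{u} R) (i : ℕ) (h : Module.Finite R (HH a i M)) :
    ∃ n, Kill a n (HH a i M) := by
  have : Tors a (HH a i M) := HH_tors a i
  obtain ⟨n, hn⟩ := this.bound ⊤ h.1
  exact ⟨n, fun c hc y => hn c hc y trivial⟩

lemma kill_mid {A B C : Type u} [AddCommGroup A] [AddCommGroup B] [AddCommGroup C]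
    [Module R A] [Module R B] [Module R C] (f : A →ₗ[R] B) (g : B →ₗ[R] C)
    (h : ∀ b, g b = 0 → ∃ x, f x = b) {m n : ℕ} (hA : Kill a m A) (hC : Kill a n C) :
    Kill a (m + n) B := by
  intro c hc y
  rw [pow_add] at hc
  refine Submodule.mul_induction_on hc ?_ ?_
  · intro d hd e he
    obtain ⟨x, hx⟩ := h (e • y) (by rw [map_smul, hC e he])
    rw [mul_smul, ← hx, ← map_smul, hA d hd, map_zero]
  · intro d e hd he
    rw [add_smul, hd, he, add_zero]

lemma exists_reg [IsNoetherianRing R] (M : Type u) [AddCommGroup M] [Module R M] [Module.Finite R M]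
    (h : Gam a M = ⊥) : ∃ x ∈ a, IsSMulRegular M x := by
  by_contra! hc
  have h1 : (a : Set R) ⊆ ⋃ p ∈ associatedPrimes R M, (p : Set R) := by
    rw [biUnion_associatedPrimes_eq_compl_regular]
    intro x hx
    exact hc x hx
  have hfin := associatedPrimes.finite R M
  have h2 : (a : Set R) ⊆ ⋃ p ∈ (hfin.toFinset : Set (Ideal R)), ((id p : Ideal R) : Set R) := by
    simpa using h1
  obtain ⟨p, hp, hap⟩ := (Ideal.subset_union_prime (f := id) ⊤ ⊤ (by
    intro i hi _ _
    exact ((Set.Finite.mem_toFinset hfin).1 hi).1)).1 h2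
  have hp' : IsAssociatedPrime p M := (Set.Finite.mem_toFinset hfin).1 hp
  rw [isAssociatedPrime_iff] at hp'
  obtain ⟨hpp, x, rfl⟩ := hp'
  have hx : x ∈ Gam a M := ⟨1, fun c hc => by
    rw [pow_one] at hc
    simpa [Submodule.mem_colon_singleton] using hap hc⟩
  rw [h, Submodule.mem_bot] at hx
  subst hx
  exact hpp.ne_top (by ext; simp [Submodule.mem_colon_singleton])

lemma Gam_quot [IsNoetherianRing R] (M : Type u) [AddCommGroup M] [Module R M] [Module.Finite R M] :
    Gam a (M ⧸ Gam a M) = ⊥ := by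
  rw [eq_bot_iff]
  intro x hx
  obtain ⟨x, rfl⟩ := (Gam a M).mkQ_surjective x
  obtain ⟨n, hn⟩ := hx
  obtain ⟨m, hm⟩ := (tors_Gam a M).bound ⊤ (IsNoetherian.noetherian _)
  rw [Submodule.mem_bot]
  refine (Submodule.Quotient.mk_eq_zero _).2 ⟨m + n, fun c hc => ?_⟩
  rw [pow_add] at hc
  refine Submodule.mul_induction_on hc ?_ ?_
  · intro d hd e he
    have h1 : e • x ∈ Gam a M := by
      have := hn e he
      rw [← map_smul] at this
      exact (Submodule.Quotient.mk_eq_zero _).1 this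
    rw [mul_smul]
    exact congrArg Subtype.val (hm d hd ⟨_, h1⟩ trivial)
  · intro d e hd he
    rw [add_smul, hd, he, add_zero]

lemma HH_zero_fin [IsNoetherianRing R] (M : Type u) [AddCommGroup M] [Module R M] [Module.Finite R M] :
    Module.Finite R (HH a 0 (ModuleCat.of R M)) := 
  have : IsNoetherian R (ModuleCat.of R M) := inferInstanceAs (IsNoetherian R M)
  Module.Finite.of_injective (evH a (ModuleCat.of R M)) (evH_inj a _)

lemma ses_facts {A B : Type u} [AddCommGroup A] [Module R A] [AddCommGroup B] [Module R B]
    (f : A →ₗ[R] B) (hf : Function.Injective f) (C : ModuleCat.{u} R)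
    (hC : C = ModuleCat.of R (B ⧸ LinearMap.range f)) :
    ∃ (g : ModuleCat.of R B ⟶ C)
      (δ : ∀ i, HH a i C →ₗ[R] HH a (i+1) (ModuleCat.of R A)),
      (∀ i y, δ i y = 0 → ∃ z, mapH a g i z = y) ∧
      (∀ i y, mapH a (ModuleCat.ofHom f) (i+1) y = 0 → ∃ z, δ i z = y) := by
  subst hC
  obtain ⟨w, hS⟩ := sesF f hf
  exact ⟨ModuleCat.ofHom (LinearMap.range f).mkQ, fun i => delH a hS i, ex3 a hS, ex1 a hS⟩

lemma step [IsNoetherianRing R] (r : ℕ) 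
    (ih : ∀ (M : Type u) [AddCommGroup M] [Module R M] [Module.Finite R M],
      (∀ i < r, Module.Finite R (HH a i (ModuleCat.of R M))) →
      (∃ n, Kill a n (HH a r (ModuleCat.of R M))) → Module.Finite R (HH a r (ModuleCat.of R M)))
    (M : Type u) [AddCommGroup M] [Module R M] [Module.Finite R M] (hG : Gam a M = ⊥)
    (hf : ∀ i < r + 1, Module.Finite R (HH a i (ModuleCat.of R M)))
    (hk : ∃ n, Kill a n (HH a (r+1) (ModuleCat.of R M))) :
    Module.Finite R (HH a (r+1) (ModuleCat.of R M)) := by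
  obtain ⟨n, hn⟩ := hk
  obtain ⟨x, hx, hreg⟩ := exists_reg a M hG
  let f : M →ₗ[R] M := (x ^ n) • LinearMap.id
  have hfi : Function.Injective f := hreg.pow n
  have e : ModuleCat.ofHom f = (x ^ n) • 𝟙 (ModuleCat.of R M) := ModuleCat.hom_ext rfl
  obtain ⟨g, δ, h3, h1⟩ := ses_facts a f hfi _ rfl
  have key : Module.Finite R (HH a r (ModuleCat.of R (M ⧸ LinearMap.range f))) := by
    apply ih
    · intro i hi
      exact fin_mid (mapH a g i) (δ i) (h3 i) (hf i (by omega)) (hf (i+1) (by omega))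
    · obtain ⟨m, hm⟩ := kill_of_fg a _ r (hf r (by omega))
      exact ⟨m + n, kill_mid a (mapH a g r) (δ r) (h3 r) hm hn⟩
  refine Module.Finite.of_surjective (δ r) ?_
  intro y
  apply h1 r y
  rw [e, mapH_smul]
  exact hn _ (Ideal.pow_mem_pow hx n) y

theorem main_fin [IsNoetherianRing R] (r : ℕ) :
    ∀ (M : Type u) [AddCommGroup M] [Module R M] [Module.Finite R M],
      (∀ i < r, Module.Finite R (HH a i (ModuleCat.of R M))) →
      (∃ n, Kill a n (HH a r (ModuleCat.of R M))) → Module.Finite R (HH a r (ModuleCat.of R M)) := by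
  induction r with
  | zero => intro M _ _ _ _ _; exact HH_zero_fin a M
  | succ r ih =>
    intro M _ _ _ hf hk
    have hS := sesQ_exact (Gam a M)
    have hsurj : ∀ i, Function.Surjective (mapH a (ModuleCat.ofHom (Gam a M).mkQ) i) := fun i y =>
      ex3 a hS i y (HH_tors_zero a i (Gam a M) (tors_Gam a M) _)
    have hfin : Module.Finite R (HH a (r+1) (ModuleCat.of R (M ⧸ Gam a M))) := by
      refine step a r ih _ (Gam_quot a M) ?_ ?_
      · intro i hi
        have := hf i hi
        exact Module.Finite.of_surjective _ (hsurj i)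
      · obtain ⟨n, hn⟩ := hk
        refine ⟨n, fun c hc y => ?_⟩
        obtain ⟨y, rfl⟩ := hsurj _ y
        rw [← map_smul, hn c hc, map_zero]
    have : IsNoetherian R (HH a (r+1) (ModuleCat.of R (M ⧸ Gam a M))) := isNoetherian_of_isNoetherianRing_of_finite R _
    refine Module.Finite.of_injective (mapH a (ModuleCat.ofHom (Gam a M).mkQ) (r+1)) ?_
    rw [injective_iff_map_eq_zero]
    intro y hy
    obtain ⟨z, rfl⟩ := ex2 a hS (r+1) y hy
    have hz : z = 0 := HH_tors_zero a r (Gam a M) (tors_Gam a M) z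
    rw [hz, map_zero]
    rfl

end main
end LCF

namespace LCF

lemma locH_fin_iff {R : Type u} [CommRing R] (a : Ideal R) (i : ℕ)
    (M : Type u) [AddCommGroup M] [Module R M] :
    Module.Finite R (locH R a i M) ↔ Module.Finite R (HH a i (ModuleCat.of R M)) :=
  ⟨fun h => by
      have e : HH a i (ModuleCat.of R M) ≃ₗ[R] locH R a i M := locEquiv a i (ModuleCat.of R M)
      exact Module.Finite.equiv e.symm,
    fun h => by
      have e : HH a i (ModuleCat.of R M) ≃ₗ[R] locH R a i M := locEquiv a i (ModuleCat.of R M)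
      exact Module.Finite.equiv e⟩

lemma locH_kill_iff {R : Type u} [CommRing R] (a : Ideal R) (i n : ℕ)
    (M : Type u) [AddCommGroup M] [Module R M] :
    a ^ n • (⊤ : Submodule R (locH R a i M)) = ⊥ ↔ Kill a n (HH a i (ModuleCat.of R M)) := by
  rw [kill_iff]
  let e : HH a i (ModuleCat.of R M) ≃ₗ[R] locH R a i M := locEquiv a i (ModuleCat.of R M)
  constructor
  · intro h c hc y
    apply e.injective
    rw [map_smul, map_zero, h c hc]
  · intro h c hc y
    apply e.symm.injective
    rw [map_smul, map_zero, h c hc]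

lemma locH_main (R : Type u) [CommRing R] [IsNoetherianRing R]
    (a : Ideal R) (r : ℕ)
    (M : Type u) [AddCommGroup M] [Module R M] [Module.Finite R M]
    (hfg : ∀ i < r, Module.Finite R (locH R a i M))
    (hann : ∃ n : ℕ, a ^ n • (⊤ : Submodule R (locH R a r M)) = ⊥) :
    Module.Finite R (locH R a r M) := by
  rw [locH_fin_iff]
  refine main_fin a r M (fun i hi => (locH_fin_iff a i M).1 (hfg i hi)) ?_
  obtain ⟨n, hn⟩ := hann
  exact ⟨n, (locH_kill_iff a r n M).1 hn⟩

lemma finDim_eq (R : Type u) [CommRing R] [IsNoetherianRing R] (a : Ideal R)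
    (M : Type u) [AddCommGroup M] [Module R M] [Module.Finite R M] :
    finDim R a M = fab R a a M := by
  apply le_antisymm
  · apply sInf_le_sInf
    apply Set.image_mono
    intro i hi hf
    obtain ⟨n, hn⟩ := kill_of_fg a _ i ((locH_fin_iff a i M).1 hf)
    exact hi n ((locH_kill_iff a i n M).2 hn)
  · apply le_sInf
    rintro _ ⟨i, hi, rfl⟩
    classical
    have hex : ∃ i, ¬ Module.Finite R (locH R a i M) := ⟨i, hi⟩
    have hle : Nat.find hex ≤ i := Nat.find_min' hex hi
    refine le_trans (sInf_le ⟨Nat.find hex, ?_, rfl⟩) (Nat.cast_le.2 hle)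
    intro n hn
    refine Nat.find_spec hex (locH_main R a _ M (fun j hj => ?_) ⟨n, hn⟩)
    exact not_not.1 (Nat.find_min hex hj)

end LCF

/-- if `H^i_a(M)` is finitely generated for all `i < r` and
`a^n H^r_a(M) = 0` for some `n`, then `H^r_a(M)` is finitely generated;
consequently `f_a(M) = f_a^a(M)`. -/
theorem locH_finite_of_pow_ann (R : Type u) [CommRing R] [IsNoetherianRing R]
    (a : Ideal R) (r : ℕ)
    (M : Type u) [AddCommGroup M] [Module R M] [Module.Finite R M]
    (hfg : ∀ i < r, Module.Finite R (locH R a i M))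
    (hann : ∃ n : ℕ, a ^ n • (⊤ : Submodule R (locH R a r M)) = ⊥) :
    Module.Finite R (locH R a r M) ∧ finDim R a M = fab R a a M := by
  exact ⟨LCF.locH_main R a r M hfg hann, LCF.finDim_eq R a M⟩
end
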